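/- arXiv:1803.04553 — 2 statements merged into one kernel-verified Lean document; each statement's English description precedes it below -/
import Mathlib

section
/- (Corollary 3.3, depth reduction for circuits with an arbitrary top gate.) Let G : {0,1}^a → {0,1} be any Boolean function, and let F be a Boolean function on {0,1}^n of the form F(x) = G(C_1(x),…,C_a(x)) where C_1,…,C_a are the outputs of depth-d AC^0 circuits of total size at most s (with s ≥ 2). Set p = (1/48)·(48·log₂ s)^{−(d−1)}. Then for every integer t ≥ 1: Pr_{ρ ← R_p}[ F↾ρ is not computed by a (2^d·t, G∘DT_{log₂ s})-decision tree ] ≤ s·2^{−t}, where a G∘DT_{log₂ s} function is one of the form y ↦ G(D_1(y),…,D_a(y)) with each D_i computed by a decision tree of depth at most log₂ s. -/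
open Finset

/-! ### AC⁰ circuits: unbounded fan-in AND/OR gates over literals -/

inductive AC0 (ι : Type) : Type
  | lit : ι → Bool → AC0 ι
  | and : (a : ℕ) → (Fin a → AC0 ι) → AC0 ι
  | or  : (a : ℕ) → (Fin a → AC0 ι) → AC0 ι

namespace AC0

variable {ι : Type}

def eval : AC0 ι → (ι → Bool) → Bool
  | .lit i b, x => if b then x i else !(x i)
  | .and _ f, x => decide (∀ j, (f j).eval x = true)
  | .or _ f, x => decide (∃ j, (f j).eval x = true)

/-- Number of gates, literals included in the count. -/
def size : AC0 ι → ℕ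
  | .lit _ _ => 1
  | .and _ f => 1 + ∑ j, (f j).size
  | .or _ f => 1 + ∑ j, (f j).size

def depth : AC0 ι → ℕ
  | .lit _ _ => 0
  | .and _ f => 1 + Finset.univ.sup fun j => (f j).depth
  | .or _ f => 1 + Finset.univ.sup fun j => (f j).depth

end AC0

/-- `g` is an arbitrary symmetric Boolean function: it depends only on the
number of `true`s among its inputs. -/
def IsSymFun {a : ℕ} (g : (Fin a → Bool) → Bool) : Prop :=
  ∃ φ : ℕ → Bool, ∀ y, g y = φ (Finset.univ.filter fun i => y i = true).card

/-- `g` is an arbitrary linear threshold function: `g y = 1` iff `∑ wᵢ yᵢ ≥ θ`. -/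
def IsThrFun {a : ℕ} (g : (Fin a → Bool) → Bool) : Prop :=
  ∃ (w : Fin a → ℝ) (θ : ℝ), ∀ y, g y = decide (θ ≤ ∑ i, if y i = true then w i else 0)

/-- `F` is computed by a SYM∘AC⁰ circuit: a symmetric output gate fed by
AC⁰ circuits of depth at most `d`, with at most `S` gates in total
(the top gate and all gates of the feeding circuits, literals included). -/
def SymOnAC0 {ι : Type} (S : ℝ) (d : ℕ) (F : (ι → Bool) → Bool) : Prop :=
  ∃ (a : ℕ) (g : (Fin a → Bool) → Bool) (C : Fin a → AC0 ι),
    IsSymFun g ∧ (∀ i, (C i).depth ≤ d) ∧ (((1 + ∑ i, (C i).size : ℕ) : ℝ) ≤ S) ∧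
    ∀ x, F x = g fun i => (C i).eval x

/-- `F` is computed by a THR∘AC⁰ circuit, analogously. -/
def ThrOnAC0 {ι : Type} (S : ℝ) (d : ℕ) (F : (ι → Bool) → Bool) : Prop :=
  ∃ (a : ℕ) (g : (Fin a → Bool) → Bool) (C : Fin a → AC0 ι),
    IsThrFun g ∧ (∀ i, (C i).depth ≤ d) ∧ (((1 + ∑ i, (C i).size : ℕ) : ℝ) ≤ S) ∧
    ∀ x, F x = g fun i => (C i).eval x

/-! ### General circuits with AND/OR gates and arbitrary SYM/THR gates -/

inductive GenCircuit (ι : Type) : Type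
  | lit : ι → Bool → GenCircuit ι
  | and : (a : ℕ) → (Fin a → GenCircuit ι) → GenCircuit ι
  | or  : (a : ℕ) → (Fin a → GenCircuit ι) → GenCircuit ι
  | sym : (a : ℕ) → (ℕ → Bool) → (Fin a → GenCircuit ι) → GenCircuit ι
  | thr : (a : ℕ) → (Fin a → ℝ) → ℝ → (Fin a → GenCircuit ι) → GenCircuit ι

namespace GenCircuit

variable {ι : Type}

noncomputable def eval : GenCircuit ι → (ι → Bool) → Bool
  | .lit i b, x => if b then x i else !(x i)
  | .and _ f, x => decide (∀ j, (f j).eval x = true)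
  | .or _ f, x => decide (∃ j, (f j).eval x = true)
  | .sym _ φ f, x => φ (Finset.univ.filter fun j => (f j).eval x = true).card
  | .thr _ w θ f, x => decide (θ ≤ ∑ j, if (f j).eval x = true then w j else 0)

/-- Number of gates, literals included in the count. -/
def size : GenCircuit ι → ℕ
  | .lit _ _ => 1
  | .and _ f => 1 + ∑ j, (f j).size
  | .or _ f => 1 + ∑ j, (f j).size
  | .sym _ _ f => 1 + ∑ j, (f j).size
  | .thr _ _ _ f => 1 + ∑ j, (f j).size

def depth : GenCircuit ι → ℕ
  | .lit _ _ => 0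
  | .and _ f => 1 + Finset.univ.sup fun j => (f j).depth
  | .or _ f => 1 + Finset.univ.sup fun j => (f j).depth
  | .sym _ _ f => 1 + Finset.univ.sup fun j => (f j).depth
  | .thr _ _ _ f => 1 + Finset.univ.sup fun j => (f j).depth

/-- The number of SYM and THR gates in the circuit. -/
def symThrCount : GenCircuit ι → ℕ
  | .lit _ _ => 0
  | .and _ f => ∑ j, (f j).symThrCount
  | .or _ f => ∑ j, (f j).symThrCount
  | .sym _ _ f => 1 + ∑ j, (f j).symThrCount
  | .thr _ _ _ f => 1 + ∑ j, (f j).symThrCount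

end GenCircuit

/-! ### Restrictions and distributions -/

/-- Apply a restriction (`none` = `*` = free) to an input. -/
def applyR {ι : Type} (ρ : ι → Option Bool) (x : ι → Bool) : ι → Bool :=
  fun i => (ρ i).getD (x i)

/-- The restricted function `f↾ρ`. -/
def restrictF {ι : Type} (f : (ι → Bool) → Bool) (ρ : ι → Option Bool) :
    (ι → Bool) → Bool :=
  fun x => f (applyR ρ x)

def freeCount {ι : Type} [Fintype ι] (ρ : ι → Option Bool) : ℕ :=
  (Finset.univ.filter fun i => ρ i = none).card

open Classical in
/-- Probability of the event `P` under the (finitely supported) density `R`. -/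
noncomputable def prOf {α : Type} [Fintype α] (R : α → ℝ) (P : α → Prop) : ℝ :=
  ∑ a, if P a then R a else 0

/-- A density `R` on restrictions is a fair distribution: it is a probability
distribution, and drawing `ρ ← R` and filling in all `*`s with independent
uniform bits yields the uniform distribution on `{0,1}^n`. -/
def IsFair {ι : Type} [Fintype ι] [DecidableEq ι] (R : (ι → Option Bool) → ℝ) : Prop :=
  (∀ ρ, 0 ≤ R ρ) ∧ ((∑ ρ : ι → Option Bool, R ρ) = 1) ∧
  ∀ x : ι → Bool,
    (∑ ρ : ι → Option Bool, R ρ * if applyR ρ x = x then ((1 : ℝ) / 2) ^ freeCount ρ else 0)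
      = ((1 : ℝ) / 2) ^ Fintype.card ι

/-- The density of the random restriction `R_p`: each coordinate independently
is `*` with probability `p`, and `0` or `1` each with probability `(1-p)/2`. -/
noncomputable def RpDensity {ι : Type} [Fintype ι] (p : ℝ) (ρ : ι → Option Bool) : ℝ :=
  ∏ i, (ρ i).elim p (fun _ => (1 - p) / 2)

/-- The density of the random subset `L ⊆_q ι` (as an indicator function):
each element is included independently with probability `q`. -/
noncomputable def subsetDensity {ι : Type} [Fintype ι] (q : ℝ) (L : ι → Bool) : ℝ :=
  ∏ i, if L i then q else 1 - q

/-- The fraction of inputs on which `F` and `H` agree. -/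
noncomputable def agreePr {ι : Type} [Fintype ι] [DecidableEq ι]
    (F H : (ι → Bool) → Bool) : ℝ :=
  ((Finset.univ.filter fun x : ι → Bool => F x = H x).card : ℝ) / 2 ^ Fintype.card ι

/-- `G : {0,1}^t → {0,1}^ι` ε-fools the Boolean function `f`. -/
def Fools {ι : Type} [Fintype ι] [DecidableEq ι] {t : ℕ}
    (G : (Fin t → Bool) → (ι → Bool)) (f : (ι → Bool) → Bool) (ε : ℝ) : Prop :=
  |(∑ s : Fin t → Bool, if f (G s) = true then (1 : ℝ) else 0) / 2 ^ t
    - (∑ x : ι → Bool, if f x = true then (1 : ℝ) else 0) / 2 ^ Fintype.card ι| ≤ ε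

/-! ### Decision trees -/

inductive DTree (ι : Type) (α : Type) : Type
  | leaf : α → DTree ι α
  | node : ι → DTree ι α → DTree ι α → DTree ι α

namespace DTree

variable {ι α : Type}

def depth : DTree ι α → ℕ
  | .leaf _ => 0
  | .node _ t0 t1 => 1 + max t0.depth t1.depth

def evalWith (ev : α → (ι → Bool) → Bool) : DTree ι α → (ι → Bool) → Bool
  | .leaf a, x => ev a x
  | .node i t0 t1, x => if x i then t1.evalWith ev x else t0.evalWith ev x

def leaves : DTree ι α → List α
  | .leaf a => [a]
  | .node _ t0 t1 => t0.leaves ++ t1.leaves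

end DTree

/-- Evaluation of an ordinary decision tree with Boolean leaves. -/
def evalDT {ι : Type} (T : DTree ι Bool) (x : ι → Bool) : Bool :=
  T.evalWith (fun b _ => b) x

/-- `F` is computed by a `(t, C)`-decision tree: a depth-`t` decision tree
whose leaves are labeled by functions from the class `C`. -/
def ComputedByClassDT {ι : Type} (t : ℕ) (C : ((ι → Bool) → Bool) → Prop)
    (F : (ι → Bool) → Bool) : Prop :=
  ∃ T : DTree ι ((ι → Bool) → Bool), T.depth ≤ t ∧ (∀ g ∈ T.leaves, C g) ∧
    ∀ x, F x = T.evalWith (fun g => g) x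

/-! ### SYM∘AND and THR∘AND circuits -/

/-- `F` is computed by a SYM∘AND circuit with at most `S` bottom AND gates
(terms), each a conjunction of at most `kb` literals. -/
def IsSymAnd {ι : Type} (S kb : ℝ) (F : (ι → Bool) → Bool) : Prop :=
  ∃ (a : ℕ) (g : (Fin a → Bool) → Bool) (T : Fin a → List (ι × Bool)),
    IsSymFun g ∧ ((a : ℝ) ≤ S) ∧ (∀ i, ((T i).length : ℝ) ≤ kb) ∧
    ∀ x, F x = g fun i => (T i).all fun l => x l.1 == l.2

/-- `F` is computed by a THR∘AND circuit, analogously. -/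
def IsThrAnd {ι : Type} (S kb : ℝ) (F : (ι → Bool) → Bool) : Prop :=
  ∃ (a : ℕ) (g : (Fin a → Bool) → Bool) (T : Fin a → List (ι × Bool)),
    IsThrFun g ∧ ((a : ℝ) ≤ S) ∧ (∀ i, ((T i).length : ℝ) ≤ kb) ∧
    ∀ x, F x = g fun i => (T i).all fun l => x l.1 == l.2

/-! ### The Razborov–Wigderson and generalized inner product functions -/

/-- Parity (XOR) of a finite family of bits. -/
def bparity {α : Type} [Fintype α] (f : α → Bool) : Bool :=
  decide ((Finset.univ.filter fun a => f a = true).card % 2 = 1)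

/-- `RW_{m,k,r}(x) = ⊕_{i∈[m]} ⋀_{j∈[k+1]} ⊕_{ℓ∈[r]} x_{i,j,ℓ}`. -/
def RW (m k r : ℕ) (x : Fin m × Fin (k + 1) × Fin r → Bool) : Bool :=
  bparity fun i : Fin m =>
    decide (∀ j : Fin (k + 1), bparity (fun ℓ : Fin r => x (i, j, ℓ)) = true)

/-- `GIP_{m',k'}(x) = ⊕_{i∈[m']} ⋀_{j∈[k']} x_{i,j}`. -/
def GIP (m' k' : ℕ) (x : Fin m' × Fin k' → Bool) : Bool :=
  bparity fun i : Fin m' => decide (∀ j : Fin k', x (i, j) = true)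

/-- `g` contains a perfect copy of `GIP_{m',k'}`: there is a restriction `κ`
whose free variables are exactly the range of an injection `e` from the GIP
index set, and bits `b`, `bb i j`, such that `g↾κ` is the corresponding
shifted/negated copy of GIP. -/
def ContainsGIP {ι : Type} (m' k' : ℕ) (g : (ι → Bool) → Bool) : Prop :=
  ∃ (κ : ι → Option Bool) (e : Fin m' × Fin k' → ι) (b : Bool)
    (bb : Fin m' × Fin k' → Bool),
    Function.Injective e ∧ (∀ v, κ v = none ↔ v ∈ Set.range e) ∧
    ∀ x : ι → Bool,
      g (applyR κ x) =
        xor b (bparity fun i : Fin m' =>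
          decide (∀ j : Fin k', xor (bb (i, j)) (x (e (i, j))) = true))

/-- `g` contains a perfect copy of `RW_{m',k',r'}`, analogously. -/
def ContainsRW {ι : Type} (m' k' r' : ℕ) (g : (ι → Bool) → Bool) : Prop :=
  ∃ (κ : ι → Option Bool) (e : Fin m' × Fin (k' + 1) × Fin r' → ι) (b : Bool)
    (bb : Fin m' × Fin (k' + 1) → Bool),
    Function.Injective e ∧ (∀ v, κ v = none ↔ v ∈ Set.range e) ∧
    ∀ x : ι → Bool,
      g (applyR κ x) =
        xor b (bparity fun i : Fin m' =>
          decide (∀ j : Fin (k' + 1),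
            xor (bb (i, j)) (bparity fun ℓ : Fin r' => x (e (i, j, ℓ))) = true))

namespace MS

set_option linter.unusedSectionVars false

variable {ι : Type} [DecidableEq ι]

/-- Overwrite `ρ` on the set `V` by the bits `σ`. -/
def setF (ρ : ι → Option Bool) (V : Finset ι) (σ : ι → Bool) : ι → Option Bool :=
  fun i => if i ∈ V then some (σ i) else ρ i

/-- The second restriction extends the first. -/
def Le (ρ ρ' : ι → Option Bool) : Prop := ∀ i b, ρ i = some b → ρ' i = some b

/-- Composition of restrictions: first `τ`, then `ρ` on the remaining stars. -/
def comp (τ ρ : ι → Option Bool) : ι → Option Bool := fun i => (τ i).elim (ρ i) some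

/-- There is a depth-`t` tree querying free variables, all of whose leaves satisfy `Q`. -/
inductive CT (Q : (ι → Option Bool) → Prop) : ℕ → (ι → Option Bool) → Prop
  | leaf (t : ℕ) (ρ : ι → Option Bool) : Q ρ → CT Q t ρ
  | node (t : ℕ) (ρ : ι → Option Bool) (i : ι) : ρ i = none →
      (∀ b, CT Q t (setF ρ {i} (fun _ => b))) → CT Q (t + 1) ρ

/-- `f↾ρ` is constant. -/
def Cst (f : (ι → Bool) → Bool) (ρ : ι → Option Bool) : Prop :=
  ∃ b, ∀ x, f (applyR ρ x) = b

theorem CT.mono {Q : (ι → Option Bool) → Prop} {t : ℕ} {ρ : ι → Option Bool}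
    (h : CT Q t ρ) : ∀ {t' : ℕ}, t ≤ t' → CT Q t' ρ := by
  induction h with
  | leaf t ρ hq => intro t' _; exact CT.leaf _ _ hq
  | node t ρ i hi _ ih =>
    intro t' ht
    obtain ⟨u, rfl⟩ : ∃ u, t' = u + 1 := ⟨t' - 1, by omega⟩
    exact CT.node _ _ i hi (fun b => ih b (by omega))

theorem CT.imp {Q Q' : (ι → Option Bool) → Prop} {t : ℕ} {ρ : ι → Option Bool}
    (h : CT Q t ρ) (hQ : ∀ ρ, Q ρ → Q' ρ) : CT Q' t ρ := by
  induction h with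
  | leaf t ρ hq => exact CT.leaf _ _ (hQ _ hq)
  | node t ρ i hi _ ih => exact CT.node _ _ i hi ih

theorem CT.hered {Q : (ι → Option Bool) → Prop} (hQ : ∀ ρ ρ', Le ρ ρ' → Q ρ → Q ρ')
    {t : ℕ} {ρ : ι → Option Bool} (h : CT Q t ρ) :
    ∀ ρ', Le ρ ρ' → CT Q t ρ' := by
  induction h with
  | leaf t ρ hq => intro ρ' hl; exact CT.leaf _ _ (hQ _ _ hl hq)
  | node t ρ i hi _ ih =>
    intro ρ' hl
    cases hc : ρ' i with
    | none =>
      refine CT.node _ _ i hc (fun b => ih b _ ?_)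
      intro j c hj
      simp only [setF] at hj ⊢
      split_ifs at hj ⊢ with h1
      · exact hj
      · exact hl _ _ hj
    | some b =>
      refine (ih b _ ?_).mono (Nat.le_succ t)
      intro j c hj
      simp only [setF, mem_singleton] at hj
      split_ifs at hj with h1
      · subst h1; rw [hc]; exact hj
      · exact hl _ _ hj

theorem applyR_le {ρ ρ' : ι → Option Bool} (h : Le ρ ρ') (x : ι → Bool) :
    applyR ρ' x = applyR ρ (applyR ρ' x) := by
  funext i
  simp only [applyR]
  cases hc : ρ i with
  | none => simp
  | some b => simp [h _ _ hc]

theorem Cst.hered (f : (ι → Bool) → Bool) (ρ ρ' : ι → Option Bool) (h : Le ρ ρ')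
    (hc : Cst f ρ) : Cst f ρ' := by
  obtain ⟨b, hb⟩ := hc
  exact ⟨b, fun x => by rw [applyR_le h, hb]⟩

theorem CT.query {Q : (ι → Option Bool) → Prop} {t : ℕ} (V : Finset ι) :
    ∀ ρ : ι → Option Bool, (∀ i ∈ V, ρ i = none) → (∀ σ, CT Q t (setF ρ V σ)) →
      CT Q (t + V.card) ρ := by
  induction V using Finset.induction_on with
  | empty =>
    intro ρ _ h
    have h0 := h (fun _ => true)
    have e : setF ρ ∅ (fun _ => true) = ρ := by funext i; simp [setF]
    rw [e] at h0
    simpa using h0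
  | insert i V hi ih =>
    intro ρ hV h
    rw [Finset.card_insert_of_notMem hi, ← Nat.add_assoc]
    refine CT.node _ _ i (hV i (by simp)) (fun b => ih _ ?_ ?_)
    · intro j hj
      have : j ≠ i := fun e => hi (e ▸ hj)
      simp [setF, this, hV j (by simp [hj])]
    · intro σ
      have := h (Function.update σ i b)
      convert this using 1
      funext j
      by_cases hji : j = i
      · subst hji; simp [setF, hi]
      · simp [setF, hji]

theorem CT.transfer {Q Q' : (ι → Option Bool) → Prop} (τ : ι → Option Bool)
    (hQ : ∀ ρ, Q ρ → Q' (comp τ ρ)) {t : ℕ} {ρ : ι → Option Bool} (h : CT Q t ρ) :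
    CT Q' t (comp τ ρ) := by
  induction h with
  | leaf t ρ hq => exact CT.leaf _ _ (hQ _ hq)
  | node t ρ i hi _ ih =>
    cases hc : τ i with
    | none =>
      refine CT.node _ _ i (by simp [comp, hc, hi]) (fun b => ?_)
      convert ih b using 1
      funext j
      by_cases hji : j = i
      · subst hji; simp [setF, comp, hc]
      · simp [setF, comp, hji]
    | some b =>
      have h2 := ih b
      have : comp τ (setF ρ {i} fun _ => b) = comp τ ρ := by
        funext j
        by_cases hji : j = i
        · subst hji; simp [setF, comp, hc]
        · simp [setF, comp, hji]
      rw [this] at h2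
      exact h2.mono (Nat.le_succ t)

theorem applyR_comp (τ ρ : ι → Option Bool) (x : ι → Bool) :
    applyR (comp τ ρ) x = applyR τ (applyR ρ x) := by
  funext i
  simp only [applyR, comp]
  cases τ i <;> simp

theorem le_comp (τ ρ : ι → Option Bool) : Le τ (comp τ ρ) := by
  intro i b h
  simp [comp, h]

theorem applyR_setF {ρ : ι → Option Bool} {i : ι} (hi : ρ i = none) (x : ι → Bool) :
    applyR (setF ρ {i} (fun _ => x i)) x = applyR ρ x := by
  funext j
  by_cases hji : j = i
  · subst hji; simp [applyR, setF, hi]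
  · simp [applyR, setF, hji]

/-- Small certificates. -/
theorem CT.cert {f : (ι → Bool) → Bool} {t : ℕ} {ρ : ι → Option Bool} (h : CT (Cst f) t ρ)
    (x : ι → Bool) : ∃ V : Finset ι, V.card ≤ t ∧
      ∀ y : ι → Bool, (∀ i ∈ V, y i = x i) → f (applyR ρ y) = f (applyR ρ x) := by
  induction h with
  | leaf t ρ hq =>
    obtain ⟨b, hb⟩ := hq
    exact ⟨∅, by simp, fun y _ => by rw [hb, hb]⟩
  | node t ρ i hi _ ih =>
    obtain ⟨V, hV, h⟩ := ih (x i)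
    refine ⟨insert i V, (Finset.card_insert_le _ _).trans (by omega), fun y hy => ?_⟩
    have h1 := h y (fun j hj => hy j (by simp [hj]))
    rw [applyR_setF hi x] at h1
    rw [← h1, ← hy i (by simp), applyR_setF hi y]

theorem CT.toDTree {f : (ι → Bool) → Bool} {t : ℕ} {ρ : ι → Option Bool}
    (h : CT (Cst f) t ρ) : ∃ T : DTree ι Bool, T.depth ≤ t ∧
      ∀ x, f (applyR ρ x) = evalDT T x := by
  induction h with
  | leaf t ρ hq =>
    obtain ⟨b, hb⟩ := hq
    exact ⟨.leaf b, by simp [DTree.depth], fun x => by rw [hb]; rfl⟩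
  | node t ρ i hi _ ih =>
    obtain ⟨T0, h0, e0⟩ := ih false
    obtain ⟨T1, h1, e1⟩ := ih true
    refine ⟨.node i T0 T1, ?_, fun x => ?_⟩
    · simp only [DTree.depth]; omega
    · rw [← applyR_setF hi x]
      cases hx : x i with
      | false => rw [e0]; simp [evalDT, DTree.evalWith, hx]
      | true => rw [e1]; simp [evalDT, DTree.evalWith, hx]

theorem CT.toClass {F : (ι → Bool) → Bool} {Q : (ι → Option Bool) → Prop}
    {K : ((ι → Bool) → Bool) → Prop} (hQ : ∀ ρ, Q ρ → K (restrictF F ρ))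
    {t : ℕ} {ρ : ι → Option Bool}
    (h : CT Q t ρ) : ComputedByClassDT t K (restrictF F ρ) := by
  induction h with
  | leaf t ρ hq =>
    refine ⟨.leaf (restrictF F ρ), by simp [DTree.depth], ?_, fun x => rfl⟩
    intro g hg
    simp only [DTree.leaves, List.mem_singleton] at hg
    subst hg
    exact hQ _ hq
  | node t ρ i hi _ ih =>
    obtain ⟨T0, h0, l0, e0⟩ := ih false
    obtain ⟨T1, h1, l1, e1⟩ := ih true
    refine ⟨.node i T0 T1, ?_, ?_, fun x => ?_⟩
    · simp only [DTree.depth]; omega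
    · intro g hg
      simp only [DTree.leaves, List.mem_append] at hg
      exact hg.elim (l0 g) (l1 g)
    · have : restrictF F ρ x = restrictF F (setF ρ {i} (fun _ => x i)) x := by
        simp only [restrictF]; rw [applyR_setF hi x]
      rw [this]
      cases hx : x i with
      | false => rw [e0]; simp [DTree.evalWith, hx]
      | true => rw [e1]; simp [DTree.evalWith, hx]

/-! ### Candidate sets -/

/-- A term: a set of variables with required values. -/
abbrev Term (ι : Type) := Finset ι × (ι → Bool)

/-- The term is falsified by the restriction. -/
def Fals (τ : ι → Option Bool) (T : Term ι) : Prop := ∃ i ∈ T.1, τ i = some (!T.2 i)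

/-- Turn a set into its indicator. -/
def ind (B : Finset ι) : ι → Bool := fun i => decide (i ∈ B)

open Classical in
/-- Candidate variable sets for one canonical path of length at least `m`. -/
noncomputable def cand (L : List (Term ι)) : ℕ → ℕ → (ι → Option Bool) → Finset (Finset ι)
  | 0, m, _ => if m = 0 then {∅} else ∅
  | F + 1, m, τ => if m = 0 then {∅} else
      match L.find? (fun T => decide (¬ Fals τ T)) with
      | none => ∅
      | some T => (T.1.powerset.filter (fun A => A.Nonempty)).biUnion fun A =>
          A.powerset.biUnion fun B =>
            ((cand L F (m - A.card) (setF τ A (ind B))).filter (fun V => Disjoint A V)).image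
              (fun V => A ∪ V)

theorem cand_card (L : List (Term ι)) : ∀ (F m : ℕ) (τ : ι → Option Bool),
    ∀ V ∈ cand L F m τ, m ≤ V.card := by
  intro F
  induction F with
  | zero =>
    intro m τ V hV
    simp only [cand] at hV
    split_ifs at hV with h
    · omega
    · simp at hV
  | succ F ih =>
    intro m τ V hV
    simp only [cand] at hV
    split_ifs at hV with h
    · omega
    · split at hV
      · simp at hV
      · simp only [mem_biUnion, mem_image, mem_filter] at hV
        obtain ⟨A, _, B, _, W, ⟨hW, hd⟩, rfl⟩ := hV
        rw [Finset.card_union_of_disjoint hd]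
        have := ih _ _ _ hW
        omega

theorem sum_biUnion_le' {α β : Type} [DecidableEq β] (s : Finset α) (t : α → Finset β)
    (g : β → ℝ) (hg : ∀ b, 0 ≤ g b) :
    ∑ b ∈ s.biUnion t, g b ≤ ∑ a ∈ s, ∑ b ∈ t a, g b := by
  classical
  induction s using Finset.induction_on with
  | empty => simp
  | insert a s ha ih =>
    rw [Finset.biUnion_insert, Finset.sum_insert ha]
    have := Finset.sum_union_inter (s₁ := t a) (s₂ := s.biUnion t) (f := g)
    have h0 : 0 ≤ ∑ b ∈ t a ∩ s.biUnion t, g b := Finset.sum_nonneg fun b _ => hg b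
    linarith

theorem sum_image_le' {α β : Type} [DecidableEq β] (s : Finset α) (e : α → β)
    (g : β → ℝ) (hg : ∀ b, 0 ≤ g b) :
    ∑ b ∈ s.image e, g b ≤ ∑ a ∈ s, g (e a) := by
  have : s.image e = s.biUnion fun a => {e a} := by ext; simp [eq_comm]
  rw [this]
  refine (sum_biUnion_le' _ _ _ hg).trans (le_of_eq ?_)
  simp

theorem sum_union_image_le (s : Finset (Finset ι)) (A : Finset ι) (x : ℝ) (hx : 0 ≤ x) :
    ∑ V ∈ (s.filter (fun V => Disjoint A V)).image (fun V => A ∪ V), x ^ V.card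
      ≤ x ^ A.card * ∑ V ∈ s, x ^ V.card := by
  refine (sum_image_le' _ _ _ (fun b => by positivity)).trans ?_
  rw [Finset.mul_sum]
  calc ∑ V ∈ s.filter (fun V => Disjoint A V), x ^ (A ∪ V).card
      = ∑ V ∈ s.filter (fun V => Disjoint A V), x ^ A.card * x ^ V.card := by
        refine Finset.sum_congr rfl fun V hV => ?_
        rw [Finset.card_union_of_disjoint (Finset.mem_filter.1 hV).2, pow_add]
    _ ≤ _ := Finset.sum_le_sum_of_subset_of_nonneg (Finset.filter_subset _ _)
        (fun _ _ _ => by positivity)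

theorem cand_sum (L : List (Term ι)) (k : ℕ) (hL : ∀ T ∈ L, T.1.card ≤ k) (x : ℝ) (hx : 0 ≤ x)
    (hxk : (1 + 2 * x) ^ k ≤ 2) : ∀ (F m : ℕ) (τ : ι → Option Bool),
    ∑ V ∈ cand L F m τ, x ^ V.card ≤ 1 := by
  intro F
  induction F with
  | zero =>
    intro m τ
    simp only [cand]
    split_ifs <;> simp
  | succ F ih =>
    intro m τ
    simp only [cand]
    split_ifs
    · simp
    · split
      · simp
      · rename_i T hT
        have hTk := hL T (List.mem_of_find?_eq_some hT)
        refine (sum_biUnion_le' _ _ _ (fun b => by positivity)).trans ?_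
        have step : ∀ A ∈ T.1.powerset.filter (fun A => A.Nonempty),
            ∑ V ∈ A.powerset.biUnion (fun B =>
              ((cand L F (m - A.card) (setF τ A (ind B))).filter (fun V => Disjoint A V)).image
              (fun V => A ∪ V)), x ^ V.card ≤ (2 * x) ^ A.card := by
          intro A _
          refine (sum_biUnion_le' _ _ _ (fun b => by positivity)).trans ?_
          calc _ ≤ ∑ B ∈ A.powerset, x ^ A.card := by
                refine Finset.sum_le_sum fun B _ => ?_
                refine (sum_union_image_le _ _ _ hx).trans ?_
                exact mul_le_of_le_one_right (by positivity) (ih _ _)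
            _ = (2 * x) ^ A.card := by
                rw [Finset.sum_const, Finset.card_powerset, mul_pow, nsmul_eq_mul]; push_cast; rfl
        refine (Finset.sum_le_sum step).trans ?_
        have h1 := Finset.sum_pow_mul_eq_add_pow (2 * x) 1 T.1
        simp only [one_pow, mul_one] at h1
        have h2 : T.1.powerset.filter (fun A => A.Nonempty) = T.1.powerset.erase ∅ := by
          ext A; simp [Finset.nonempty_iff_ne_empty, and_comm]
        have h3 := Finset.add_sum_erase T.1.powerset (fun A => (2 * x) ^ A.card)
          (Finset.empty_mem_powerset _)
        rw [h2]
        have h4 : (2 * x + 1) ^ T.1.card ≤ 2 := by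
          refine le_trans ?_ hxk
          rw [add_comm]
          exact pow_le_pow_right₀ (by linarith) hTk
        simp only [Finset.card_empty, pow_zero] at h3
        linarith

/-- `g` (up to the sign `b`) is the DNF `L`. -/
def IsDNF (b : Bool) (g : (ι → Bool) → Bool) (L : List (Term ι)) : Prop :=
  ∀ y, g y = b ↔ ∃ T ∈ L, ∀ i ∈ T.1, y i = T.2 i

theorem find_eq {α : Type} (L : List α) (P Q : α → Prop) [DecidablePred P] [DecidablePred Q]
    (hPQ : ∀ a, Q a → P a) (T : α) (hT : L.find? (fun a => decide (P a)) = some T) (hq : Q T) :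
    L.find? (fun a => decide (Q a)) = some T := by
  induction L with
  | nil => simp at hT
  | cons a L ih =>
    rw [List.find?_cons] at hT ⊢
    by_cases hP : P a
    · simp only [hP, decide_true, Option.some.injEq] at hT
      subst hT
      simp [hq]
    · simp only [hP, decide_false] at hT
      have : ¬ Q a := fun h => hP (hPQ _ h)
      simp only [this, decide_false]
      exact ih hT

theorem cand_exists (b : Bool) (g : (ι → Bool) → Bool) (L : List (Term ι)) (hg : IsDNF b g L) :
    ∀ (F m : ℕ) (ρ : ι → Option Bool), m ≤ F → (∀ j < m, ¬ CT (Cst g) j ρ) →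
    ∃ (V : Finset ι) (σ : ι → Bool), (∀ i ∈ V, ρ i = none) ∧
      ∀ ρ', Le (setF ρ V σ) ρ' → V ∈ cand L F m ρ' := by
  classical
  intro F
  induction F with
  | zero =>
    intro m ρ hm _
    refine ⟨∅, fun _ => true, by simp, fun ρ' _ => ?_⟩
    have : m = 0 := by omega
    simp [cand, this]
  | succ F ih =>
    intro m ρ hm hbad
    rcases Nat.eq_zero_or_pos m with rfl | hpos
    · exact ⟨∅, fun _ => true, by simp, fun ρ' _ => by simp [cand]⟩
    have hnc : ¬ Cst g ρ := fun h => hbad 0 hpos (CT.leaf _ _ h)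
    cases hfind : L.find? (fun T => decide (¬ Fals ρ T)) with
    | none =>
      exfalso
      apply hnc
      refine ⟨!b, fun x => ?_⟩
      by_contra hne
      have hx : g (applyR ρ x) = b := by
        cases hb : g (applyR ρ x) <;> cases b <;> simp_all
      obtain ⟨T, hT, hsat⟩ := (hg _).1 hx
      have := List.find?_eq_none.1 hfind T hT
      simp only [decide_not, Bool.not_eq_true', decide_eq_false_iff_not, not_not] at this
      obtain ⟨i, hi, hf⟩ := this
      have h2 := hsat i hi
      simp [applyR, hf] at h2
    | some T =>
      have hTL := List.mem_of_find?_eq_some hfind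
      have hTn : ¬ Fals ρ T := by simpa using List.find?_some hfind
      set U := T.1.filter (fun i => ρ i = none) with hU
      have hUne : U.Nonempty := by
        by_contra hemp
        rw [Finset.not_nonempty_iff_eq_empty] at hemp
        apply hnc
        refine ⟨b, fun x => (hg _).2 ⟨T, hTL, fun i hi => ?_⟩⟩
        cases hc : ρ i with
        | none =>
          have : i ∈ U := by simp [hU, hi, hc]
          simp [hemp] at this
        | some c =>
          simp only [applyR, hc, Option.getD_some]
          by_contra hne
          refine hTn ⟨i, hi, ?_⟩
          rw [hc]
          cases c <;> cases hh : T.2 i <;> simp_all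
      have hUs : ∀ i ∈ U, ρ i = none := fun i hi => (Finset.mem_filter.1 hi).2
      have hUpos := hUne.card_pos
      obtain ⟨α, hα⟩ : ∃ α : ι → Bool, ∀ j < m - U.card, ¬ CT (Cst g) j (setF ρ U α) := by
        by_cases hle : m ≤ U.card
        · exact ⟨fun _ => true, fun j hj => by omega⟩
        · by_contra hcon
          push Not at hcon
          refine hbad (m - 1) (by omega) ?_
          have := CT.query (Q := Cst g) (t := m - 1 - U.card) U ρ hUs (fun σ => ?_)
          · exact this.mono (by omega)
          · obtain ⟨j, hj, hc⟩ := hcon σ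
            exact hc.mono (by omega)
      obtain ⟨V, σ, hV, hVc⟩ := ih (m - U.card) (setF ρ U α) (by omega) hα
      have hVU : ∀ i ∈ V, i ∉ U := by
        intro i hi hiU
        have := hV i hi
        simp [setF, hiU] at this
      refine ⟨U ∪ V, fun i => if i ∈ U then T.2 i else σ i, ?_, fun ρ' hρ' => ?_⟩
      · intro i hi
        rcases Finset.mem_union.1 hi with h | h
        · exact hUs i h
        · have := hV i h
          simpa [setF, hVU i h] using this
      · have hkeep : ∀ i c, ρ i = some c → ρ' i = some c := by
          intro i c hc
          apply hρ'
          have h1 : i ∉ U := fun h => by simp [hUs i h] at hc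
          have h2 : i ∉ V := fun h => by
            have := hV i h
            simp [setF, h1, hc] at this
          simp [setF, h1, h2, hc]
        have hUv : ∀ i ∈ U, ρ' i = some (T.2 i) := by
          intro i hi
          apply hρ'
          simp [setF, hi]
        have hf' : L.find? (fun T => decide (¬ Fals ρ' T)) = some T := by
          refine find_eq L (fun T => ¬ Fals ρ T) (fun T => ¬ Fals ρ' T) ?_ T hfind ?_
          · rintro S hS ⟨i, hi, hf⟩
            exact hS ⟨i, hi, hkeep _ _ hf⟩
          · rintro ⟨i, hi, hf⟩
            by_cases hiU : i ∈ U
            · rw [hUv i hiU] at hf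
              simp at hf
            · cases hc : ρ i with
              | none => exact hiU (by simp [hU, hi, hc])
              | some c =>
                rw [hkeep _ _ hc] at hf
                exact hTn ⟨i, hi, by rw [hc, hf]⟩
        have hm0 : m ≠ 0 := by omega
        simp only [cand, hm0, if_false, hf']
        simp only [mem_biUnion, mem_image, mem_filter, mem_powerset]
        refine ⟨U, ⟨Finset.filter_subset _ _, hUne⟩, U.filter (fun i => α i = true),
          Finset.filter_subset _ _, V, ⟨hVc _ ?_, ?_⟩, rfl⟩
        · intro i c hc
          by_cases hiU : i ∈ U
          · have hiV : i ∉ V := fun h => hVU i h hiU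
            simp only [setF, hiU, hiV, if_true, if_false] at hc ⊢
            rw [← hc]
            simp [ind, hiU]
          · simp only [setF, hiU, if_false] at hc ⊢
            apply hρ'
            simp only [setF, mem_union, hiU, false_or, if_false]
            exact hc
        · rw [Finset.disjoint_left]
          exact fun i hi h => hVU i h hi

/-- Candidate sets for the common tree. -/
noncomputable def out {J : ℕ} (L : Fin J → List (Term ι)) (l : ℕ) :
    ℕ → ℕ → (ι → Option Bool) → Finset (Finset ι)
  | 0, t, _ => if t = 0 then {∅} else ∅
  | F + 1, t, τ => if t = 0 then {∅} else
      Finset.univ.biUnion fun j => (cand (L j) (l + 1) (l + 1) τ).biUnion fun V =>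
        V.powerset.biUnion fun B =>
          ((out L l F (t - V.card) (setF τ V (ind B))).filter (fun W => Disjoint V W)).image
            (fun W => V ∪ W)

theorem out_sum {J : ℕ} (L : Fin J → List (Term ι)) (l k : ℕ) (hJ : J ≤ 2 ^ (l + 1))
    (hL : ∀ j, ∀ T ∈ L j, T.1.card ≤ k) (x r : ℝ) (hr : 0 ≤ r) (hrx : 8 * r ≤ x)
    (hxk : (1 + 2 * x) ^ k ≤ 2) : ∀ (F t : ℕ) (τ : ι → Option Bool),
    ∑ V ∈ out L l F t τ, r ^ V.card ≤ if t = 0 then 1 else (J : ℝ) * (1 / 2) ^ t := by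
  have hx : 0 ≤ x := by linarith
  intro F
  induction F with
  | zero =>
    intro t τ
    simp only [out]
    split_ifs
    · simp
    · simp
  | succ F ih =>
    intro t τ
    simp only [out]
    split_ifs with ht
    · simp
    refine (sum_biUnion_le' _ _ _ (fun b => by positivity)).trans ?_
    have key : ∀ j : Fin J, ∑ V ∈ (cand (L j) (l + 1) (l + 1) τ).biUnion (fun V =>
        V.powerset.biUnion fun B =>
          ((out L l F (t - V.card) (setF τ V (ind B))).filter (fun W => Disjoint V W)).image
            (fun W => V ∪ W)), r ^ V.card ≤ (1 / 2) ^ t := by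
      intro j
      refine (sum_biUnion_le' _ _ _ (fun b => by positivity)).trans ?_
      calc _ ≤ ∑ V ∈ cand (L j) (l + 1) (l + 1) τ, (1 / 2 : ℝ) ^ t * x ^ V.card := by
            refine Finset.sum_le_sum fun V hV => ?_
            have hVc := cand_card _ _ _ _ V hV
            refine (sum_biUnion_le' _ _ _ (fun b => by positivity)).trans ?_
            have h1 : ∀ B ∈ V.powerset, ∑ W ∈ ((out L l F (t - V.card) (setF τ V (ind B))).filter
                (fun W => Disjoint V W)).image (fun W => V ∪ W), r ^ W.card ≤
                r ^ V.card * (4 ^ V.card * (1 / 2) ^ t) := by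
              intro B _
              refine (sum_union_image_le _ _ _ hr).trans ?_
              refine mul_le_mul_of_nonneg_left ((ih _ _).trans ?_) (by positivity)
              split_ifs with h0
              · have : (1 / 2 : ℝ) ^ V.card ≤ (1 / 2) ^ t :=
                  pow_le_pow_of_le_one (by norm_num) (by norm_num) (by omega)
                calc (1 : ℝ) ≤ 4 ^ V.card * (1 / 2) ^ V.card := by
                      rw [← mul_pow]; exact one_le_pow₀ (by norm_num)
                  _ ≤ _ := mul_le_mul_of_nonneg_left this (by positivity)
              · have e : (1 / 2 : ℝ) ^ t = (1 / 2) ^ (t - V.card) * (1 / 2) ^ V.card := by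
                  rw [← pow_add]; congr 1; omega
                have e2 : (4 : ℝ) ^ V.card * (1 / 2) ^ V.card = 2 ^ V.card := by
                  rw [← mul_pow]; norm_num
                have hJ2 : (J : ℝ) ≤ 2 ^ V.card := by
                  have : J ≤ 2 ^ V.card := hJ.trans (Nat.pow_le_pow_right (by norm_num) hVc)
                  exact_mod_cast this
                calc (J : ℝ) * (1 / 2) ^ (t - V.card)
                    ≤ 2 ^ V.card * (1 / 2) ^ (t - V.card) :=
                      mul_le_mul_of_nonneg_right hJ2 (by positivity)
                  _ = 4 ^ V.card * (1 / 2) ^ t := by rw [e, ← e2]; ring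
            refine (Finset.sum_le_sum h1).trans ?_
            rw [Finset.sum_const, Finset.card_powerset, nsmul_eq_mul]
            push_cast
            have h2 : (8 * r) ^ V.card ≤ x ^ V.card := by gcongr
            have h3 : (2 : ℝ) ^ V.card * (r ^ V.card * (4 ^ V.card * (1 / 2) ^ t)) =
              (8 * r) ^ V.card * (1 / 2) ^ t := by
              rw [mul_pow, show (8 : ℝ) = 2 * 4 by norm_num, mul_pow]; ring
            rw [h3, mul_comm]
            exact mul_le_mul_of_nonneg_left h2 (by positivity)
        _ ≤ (1 / 2) ^ t := by
            rw [← Finset.mul_sum]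
            exact mul_le_of_le_one_right (by positivity) (cand_sum _ k (hL j) x hx hxk _ _ _)
    refine (Finset.sum_le_sum fun j _ => key j).trans ?_
    simp

theorem out_exists {J : ℕ} (L : Fin J → List (Term ι)) (b : Fin J → Bool)
    (g : Fin J → (ι → Bool) → Bool) (hg : ∀ j, IsDNF (b j) (g j) (L j)) (l : ℕ) :
    ∀ (F t : ℕ) (ρ : ι → Option Bool), t ≤ F →
    ¬ CT (fun ρ => ∀ j, CT (Cst (g j)) l ρ) t ρ →
    ∃ (V : Finset ι) (σ : ι → Bool), (∀ i ∈ V, ρ i = none) ∧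
      ∀ ρ', Le (setF ρ V σ) ρ' → V ∈ out L l F t ρ' := by
  classical
  intro F
  induction F with
  | zero =>
    intro t ρ ht _
    refine ⟨∅, fun _ => true, by simp, fun ρ' _ => ?_⟩
    have : t = 0 := by omega
    simp [out, this]
  | succ F ih =>
    intro t ρ ht hbad
    rcases Nat.eq_zero_or_pos t with rfl | hpos
    · exact ⟨∅, fun _ => true, by simp, fun ρ' _ => by simp [out]⟩
    have hnq : ¬ ∀ j, CT (Cst (g j)) l ρ := fun h => hbad (CT.leaf _ _ h)
    push Not at hnq
    obtain ⟨j, hj⟩ := hnq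
    obtain ⟨U, σ1, hUs, hUc⟩ := cand_exists (b j) (g j) (L j) (hg j) (l + 1) (l + 1) ρ le_rfl
      (fun i hi h => hj (h.mono (by omega)))
    have hUpos : l + 1 ≤ U.card := cand_card _ _ _ _ U (hUc _ (fun _ _ h => h))
    obtain ⟨V, σ, α, hV, hVc⟩ : ∃ (V : Finset ι) (σ α : ι → Bool),
        (∀ i ∈ V, setF ρ U α i = none) ∧
        ∀ ρ', Le (setF (setF ρ U α) V σ) ρ' → V ∈ out L l F (t - U.card) ρ' := by
      by_cases hle : t ≤ U.card
      · refine ⟨∅, fun _ => true, fun _ => true, by simp, fun ρ' _ => ?_⟩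
        have h0 : t - U.card = 0 := by omega
        rw [h0]
        cases F <;> simp [out]
      · have : ∃ α : ι → Bool, ¬ CT (fun ρ => ∀ j, CT (Cst (g j)) l ρ) (t - U.card)
            (setF ρ U α) := by
          by_contra hcon
          push Not at hcon
          exact hbad ((CT.query U ρ hUs hcon).mono (by omega))
        obtain ⟨α, hα⟩ := this
        obtain ⟨V, σ, h1, h2⟩ := ih (t - U.card) (setF ρ U α) (by omega) hα
        exact ⟨V, σ, α, h1, h2⟩
    have hVU : ∀ i ∈ V, i ∉ U := by
      intro i hi hiU
      have := hV i hi
      simp [setF, hiU] at this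
    refine ⟨U ∪ V, fun i => if i ∈ U then σ1 i else σ i, ?_, fun ρ' hρ' => ?_⟩
    · intro i hi
      rcases Finset.mem_union.1 hi with h | h
      · exact hUs i h
      · have := hV i h
        simpa [setF, hVU i h] using this
    · have ht0 : t ≠ 0 := by omega
      simp only [out, ht0, if_false]
      simp only [mem_biUnion, mem_image, mem_filter, mem_powerset]
      refine ⟨j, Finset.mem_univ _, U, hUc _ ?_, U.filter (fun i => α i = true),
        Finset.filter_subset _ _, V, ⟨hVc _ ?_, ?_⟩, rfl⟩
      · intro i c hc
        apply hρ'
        by_cases hiU : i ∈ U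
        · simpa [setF, hiU] using hc
        · simp only [setF, hiU, if_false] at hc
          have hiV : i ∉ V := fun h => by
            have := hV i h
            simp [setF, hiU, hc] at this
          simp [setF, hiU, hiV, hc]
      · intro i c hc
        by_cases hiU : i ∈ U
        · have hiV : i ∉ V := fun h => hVU i h hiU
          simp only [setF, hiU, hiV, if_true, if_false] at hc ⊢
          rw [← hc]
          simp [ind, hiU]
        · simp only [setF, hiU, if_false] at hc ⊢
          apply hρ'
          simp only [setF, mem_union, hiU, false_or, if_false]
          exact hc
      · rw [Finset.disjoint_left]
        exact fun i hi h => hVU i h hi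

/-! ### Probability -/

variable [Fintype ι]

theorem Rp_nonneg {p : ℝ} (h0 : 0 ≤ p) (h1 : p ≤ 1) (ρ : ι → Option Bool) :
    0 ≤ RpDensity p ρ := by
  refine Finset.prod_nonneg fun i _ => ?_
  cases ρ i <;> simp <;> linarith

theorem Rp_sum (p : ℝ) : ∑ ρ : ι → Option Bool, RpDensity p ρ = 1 := by
  unfold RpDensity
  rw [← Fintype.prod_sum (fun (_ : ι) (o : Option Bool) => o.elim p (fun _ => (1 - p) / 2))]
  refine Finset.prod_eq_one fun i _ => ?_
  rw [Fintype.sum_option, Fintype.sum_bool]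
  simp

theorem prOf_mono {α : Type} [Fintype α] {R : α → ℝ} (hR : ∀ a, 0 ≤ R a) {P P' : α → Prop}
    (h : ∀ a, P a → P' a) : prOf R P ≤ prOf R P' := by
  classical
  unfold prOf
  refine Finset.sum_le_sum fun a _ => ?_
  by_cases h1 : P a
  · simp [h1, h a h1]
  · simp only [h1, if_false]
    split_ifs
    · exact hR a
    · exact le_rfl

theorem prOf_or {α : Type} [Fintype α] {R : α → ℝ} (hR : ∀ a, 0 ≤ R a) {P P' : α → Prop} :
    prOf R (fun a => P a ∨ P' a) ≤ prOf R P + prOf R P' := by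
  classical
  unfold prOf
  rw [← Finset.sum_add_distrib]
  refine Finset.sum_le_sum fun a _ => ?_
  have := hR a
  by_cases h1 : P a <;> by_cases h2 : P' a <;> simp [h1, h2] <;> linarith

theorem prOf_le_one {p : ℝ} (h0 : 0 ≤ p) (h1 : p ≤ 1) (P : (ι → Option Bool) → Prop) :
    prOf (RpDensity p) P ≤ 1 := by
  classical
  rw [← Rp_sum (ι := ι) p]
  unfold prOf
  refine Finset.sum_le_sum fun a _ => ?_
  have := Rp_nonneg h0 h1 a
  split_ifs <;> linarith

theorem Rp_comp (p q : ℝ) (ρ : ι → Option Bool) :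
    RpDensity (p * q) ρ = ∑ ρ1 : ι → Option Bool, ∑ ρ2 : ι → Option Bool,
      if comp ρ1 ρ2 = ρ then RpDensity p ρ1 * RpDensity q ρ2 else 0 := by
  classical
  have e1 : ∀ ρ1 ρ2 : ι → Option Bool,
      (if comp ρ1 ρ2 = ρ then RpDensity p ρ1 * RpDensity q ρ2 else 0) =
      ∏ i, (if (ρ1 i).elim (ρ2 i) some = ρ i then
        (ρ1 i).elim p (fun _ => (1 - p) / 2) * (ρ2 i).elim q (fun _ => (1 - q) / 2) else 0) := by
    intro ρ1 ρ2
    split_ifs with h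
    · unfold RpDensity
      rw [← Finset.prod_mul_distrib]
      refine Finset.prod_congr rfl fun i _ => ?_
      have : (ρ1 i).elim (ρ2 i) some = ρ i := congrFun h i
      rw [if_pos this]
    · obtain ⟨i, hi⟩ := Function.ne_iff.1 h
      symm
      exact Finset.prod_eq_zero (Finset.mem_univ i) (if_neg hi)
  simp_rw [e1]
  have e2 : ∀ ρ1 : ι → Option Bool, ∑ ρ2 : ι → Option Bool,
      ∏ i, (if (ρ1 i).elim (ρ2 i) some = ρ i then
        (ρ1 i).elim p (fun _ => (1 - p) / 2) * (ρ2 i).elim q (fun _ => (1 - q) / 2) else 0) =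
      ∏ i, ∑ c : Option Bool, (if (ρ1 i).elim c some = ρ i then
        (ρ1 i).elim p (fun _ => (1 - p) / 2) * c.elim q (fun _ => (1 - q) / 2) else 0) := by
    intro ρ1
    rw [Fintype.prod_sum]
  simp_rw [e2]
  rw [← Fintype.prod_sum (fun (i : ι) (o : Option Bool) => ∑ c : Option Bool,
    (if o.elim c some = ρ i then
        o.elim p (fun _ => (1 - p) / 2) * c.elim q (fun _ => (1 - q) / 2) else 0))]
  unfold RpDensity
  refine Finset.prod_congr rfl fun i _ => ?_
  simp only [Fintype.sum_option, Fintype.sum_bool]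
  cases ρ i with
  | none => simp
  | some b => cases b <;> simp <;> ring

theorem prOf_comp (p q : ℝ) (P : (ι → Option Bool) → Prop) :
    prOf (RpDensity (p * q)) P =
      ∑ ρ1 : ι → Option Bool, RpDensity p ρ1 * prOf (RpDensity q) (fun ρ2 => P (comp ρ1 ρ2)) := by
  classical
  unfold prOf
  simp_rw [Rp_comp p q, Finset.mul_sum]
  have : ∀ ρ : ι → Option Bool, (if P ρ then ∑ ρ1 : ι → Option Bool, ∑ ρ2 : ι → Option Bool,
      (if comp ρ1 ρ2 = ρ then RpDensity p ρ1 * RpDensity q ρ2 else 0) else 0) =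
      ∑ ρ1 : ι → Option Bool, ∑ ρ2 : ι → Option Bool,
      (if comp ρ1 ρ2 = ρ then (if P (comp ρ1 ρ2) then RpDensity p ρ1 * RpDensity q ρ2 else 0)
        else 0) := by
    intro ρ
    split_ifs with h
    · refine Finset.sum_congr rfl fun ρ1 _ => Finset.sum_congr rfl fun ρ2 _ => ?_
      split_ifs with h1 h2
      · rfl
      · exact absurd (h1 ▸ h) h2
      · rfl
    · symm
      refine Finset.sum_eq_zero fun ρ1 _ => Finset.sum_eq_zero fun ρ2 _ => ?_
      split_ifs with h1 h2
      · exact absurd (h1 ▸ h2) h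
      · rfl
      · rfl
  simp_rw [this]
  rw [Finset.sum_comm]
  refine Finset.sum_congr rfl fun ρ1 _ => ?_
  rw [Finset.sum_comm]
  refine Finset.sum_congr rfl fun ρ2 _ => ?_
  rw [Finset.sum_ite_eq]
  simp

/-- Make the variables of `V` free. -/
def star (ρ : ι → Option Bool) (V : Finset ι) : ι → Option Bool :=
  fun i => if i ∈ V then none else ρ i

theorem Rp_setF {p : ℝ} (h1 : p < 1) (ρ : ι → Option Bool) (V : Finset ι) (σ : ι → Bool)
    (hV : ∀ i ∈ V, ρ i = none) :
    RpDensity p ρ = (2 * p / (1 - p)) ^ V.card * RpDensity p (setF ρ V σ) := by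
  classical
  have h2 : (1 - p) ≠ 0 := by linarith
  unfold RpDensity
  have : (2 * p / (1 - p)) ^ V.card = ∏ i : ι, if i ∈ V then (2 * p / (1 - p)) else 1 := by
    rw [Finset.prod_ite_mem, Finset.univ_inter, Finset.prod_const]
  rw [this, ← Finset.prod_mul_distrib]
  refine Finset.prod_congr rfl fun i _ => ?_
  by_cases hi : i ∈ V
  · simp [setF, hi, hV i hi]; field_simp
  · simp [setF, hi]

theorem switch_count {p : ℝ} (h0 : 0 ≤ p) (h1 : p < 1) (Bad : (ι → Option Bool) → Prop)
    (O : (ι → Option Bool) → Finset (Finset ι)) (c : ℝ)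
    (hO : ∀ ρ, ∑ V ∈ O ρ, (2 * p / (1 - p)) ^ V.card ≤ c)
    (hB : ∀ ρ, Bad ρ → ∃ (V : Finset ι) (σ : ι → Bool), (∀ i ∈ V, ρ i = none) ∧
      V ∈ O (setF ρ V σ)) : prOf (RpDensity p) Bad ≤ c := by
  classical
  have hr : 0 ≤ 2 * p / (1 - p) := div_nonneg (by linarith) (by linarith)
  set r := 2 * p / (1 - p) with hrdef
  have hw := Rp_nonneg (ι := ι) h0 h1.le
  have step : ∀ ρ : ι → Option Bool, (if Bad ρ then RpDensity p ρ else 0) ≤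
      ∑ ρ' : ι → Option Bool, ∑ V ∈ O ρ',
        if star ρ' V = ρ then r ^ V.card * RpDensity p ρ' else 0 := by
    intro ρ
    have nn : ∀ ρ' : ι → Option Bool, ∀ V : Finset ι,
        0 ≤ if star ρ' V = ρ then r ^ V.card * RpDensity p ρ' else 0 := by
      intro ρ' V
      split_ifs
      · exact mul_nonneg (pow_nonneg hr _) (hw _)
      · exact le_rfl
    split_ifs with hbad
    · obtain ⟨V, σ, hV, hVO⟩ := hB ρ hbad
      have hs : star (setF ρ V σ) V = ρ := by
        funext i
        by_cases hi : i ∈ V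
        · simp [star, hi, hV i hi]
        · simp [star, setF, hi]
      calc RpDensity p ρ = if star (setF ρ V σ) V = ρ then
            r ^ V.card * RpDensity p (setF ρ V σ) else 0 := by
            rw [if_pos hs]; exact Rp_setF h1 ρ V σ hV
        _ ≤ ∑ V' ∈ O (setF ρ V σ), if star (setF ρ V σ) V' = ρ then
            r ^ V'.card * RpDensity p (setF ρ V σ) else 0 :=
            Finset.single_le_sum (f := fun V' => if star (setF ρ V σ) V' = ρ then
              r ^ V'.card * RpDensity p (setF ρ V σ) else 0) (fun V' _ => nn _ V') hVO
        _ ≤ _ := Finset.single_le_sum (f := fun ρ' => ∑ V' ∈ O ρ', if star ρ' V' = ρ then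
              r ^ V'.card * RpDensity p ρ' else 0)
              (fun ρ' _ => Finset.sum_nonneg fun V' _ => nn ρ' V') (Finset.mem_univ _)
    · exact Finset.sum_nonneg fun ρ' _ => Finset.sum_nonneg fun V' _ => nn ρ' V'
  unfold prOf
  refine (Finset.sum_le_sum fun ρ _ => step ρ).trans ?_
  rw [Finset.sum_comm]
  calc ∑ ρ' : ι → Option Bool, ∑ ρ : ι → Option Bool, ∑ V ∈ O ρ',
        (if star ρ' V = ρ then r ^ V.card * RpDensity p ρ' else 0)
      = ∑ ρ' : ι → Option Bool, (∑ V ∈ O ρ', r ^ V.card) * RpDensity p ρ' := by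
        refine Finset.sum_congr rfl fun ρ' _ => ?_
        rw [Finset.sum_comm, Finset.sum_mul]
        refine Finset.sum_congr rfl fun V _ => ?_
        rw [Finset.sum_ite_eq]; simp
    _ ≤ ∑ ρ' : ι → Option Bool, c * RpDensity p ρ' :=
        Finset.sum_le_sum fun ρ' _ => mul_le_mul_of_nonneg_right (hO ρ') (hw _)
    _ = c := by rw [← Finset.mul_sum, Rp_sum, mul_one]

/-- Numerical facts. -/
theorem num_facts (k : ℕ) (hk : 1 ≤ k) (p : ℝ) (h0 : 0 ≤ p) (hp : p * (48 * k) ≤ 1) :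
    p < 1 ∧ 8 * (2 * p / (1 - p)) ≤ 10 / (29 * k) ∧
      (1 + 2 * (10 / (29 * k) : ℝ)) ^ k ≤ 2 := by
  have hk' : (1 : ℝ) ≤ k := by exact_mod_cast hk
  have hp48 : p * 48 ≤ 1 := by nlinarith
  refine ⟨by linarith, ?_, ?_⟩
  · have h1 : 0 < 1 - p := by linarith
    rw [← mul_div_assoc, div_le_div_iff₀ h1 (by positivity)]
    nlinarith
  · have h1 : (1 + 2 * (10 / (29 * k) : ℝ)) ≤ Real.exp (20 / 29 / k) := by
      have := Real.add_one_le_exp (20 / 29 / (k : ℝ))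
      have e : 2 * (10 / (29 * k) : ℝ) = 20 / 29 / k := by field_simp; norm_num
      rw [e]; linarith
    calc (1 + 2 * (10 / (29 * k) : ℝ)) ^ k ≤ (Real.exp (20 / 29 / k)) ^ k := by
          gcongr
      _ = Real.exp (20 / 29) := by
          rw [← Real.exp_nat_mul]; congr 1; field_simp
      _ ≤ Real.exp (Real.log 2) := by
          apply Real.exp_le_exp.2
          have := Real.log_two_gt_d9
          linarith
      _ = 2 := Real.exp_log (by norm_num)

/-- The multi-switching lemma. -/
theorem multi_switch {J : ℕ} (L : Fin J → List (Term ι)) (b : Fin J → Bool)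
    (g : Fin J → (ι → Bool) → Bool) (hg : ∀ j, IsDNF (b j) (g j) (L j)) (l k : ℕ) (hk : 1 ≤ k)
    (hJ : J ≤ 2 ^ (l + 1)) (hL : ∀ j, ∀ T ∈ L j, T.1.card ≤ k) (p : ℝ) (h0 : 0 ≤ p)
    (hp : p * (48 * k) ≤ 1) (t : ℕ) (ht : 1 ≤ t) :
    prOf (RpDensity p) (fun ρ => ¬ CT (fun ρ => ∀ j, CT (Cst (g j)) l ρ) t ρ)
      ≤ (J : ℝ) * (1 / 2) ^ t := by
  obtain ⟨hp1, hA, hB⟩ := num_facts k hk p h0 hp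
  refine switch_count h0 hp1 _ (out L l t t) _ (fun ρ => ?_) (fun ρ hρ => ?_)
  · have hr : 0 ≤ 2 * p / (1 - p) := div_nonneg (by linarith) (by linarith)
    have := out_sum L l k hJ hL _ _ hr hA hB t t ρ
    rwa [if_neg (by omega)] at this
  · obtain ⟨V, σ, h1, h2⟩ := out_exists L b g hg l t t ρ le_rfl hρ
    exact ⟨V, σ, h1, h2 _ (fun _ _ h => h)⟩

/-! ### Circuits -/

/-- All subcircuits. -/
def subs : AC0 ι → List (AC0 ι)
  | .lit i b => [.lit i b]
  | .and a f => .and a f :: (List.finRange a).flatMap (fun j => subs (f j))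
  | .or a f => .or a f :: (List.finRange a).flatMap (fun j => subs (f j))

theorem subs_length (c : AC0 ι) : (subs c).length = c.size := by
  induction c with
  | lit i b => simp [subs, AC0.size]
  | and a f ih =>
    simp only [subs, AC0.size, List.length_cons, List.length_flatMap, ih]
    rw [Fin.sum_univ_def]; omega
  | or a f ih =>
    simp only [subs, AC0.size, List.length_cons, List.length_flatMap, ih]
    rw [Fin.sum_univ_def]; omega

theorem self_mem_subs (c : AC0 ι) : c ∈ subs c := by
  cases c <;> simp [subs]

/-- A list of circuits closed under taking children. -/
def Closed (M : List (AC0 ι)) : Prop :=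
  ∀ a (f : Fin a → AC0 ι), (AC0.and a f ∈ M ∨ AC0.or a f ∈ M) → ∀ j, f j ∈ M

theorem subs_closed (c : AC0 ι) : Closed (subs c) := by
  induction c with
  | lit i b => intro a f h; simp [subs] at h
  | and a f ih =>
    intro a' f' h j
    simp only [subs, List.mem_cons, List.mem_flatMap, List.mem_finRange, true_and] at h ⊢
    rcases h with (h | ⟨i, h⟩) | (h | ⟨i, h⟩)
    · cases h; exact Or.inr ⟨j, self_mem_subs _⟩
    · exact Or.inr ⟨i, ih i a' f' (Or.inl h) j⟩
    · cases h
    · exact Or.inr ⟨i, ih i a' f' (Or.inr h) j⟩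
  | or a f ih =>
    intro a' f' h j
    simp only [subs, List.mem_cons, List.mem_flatMap, List.mem_finRange, true_and] at h ⊢
    rcases h with (h | ⟨i, h⟩) | (h | ⟨i, h⟩)
    · cases h
    · exact Or.inr ⟨i, ih i a' f' (Or.inl h) j⟩
    · cases h; exact Or.inr ⟨j, self_mem_subs _⟩
    · exact Or.inr ⟨i, ih i a' f' (Or.inr h) j⟩

/-- All circuits of `M` of depth at most `d` are shallow trees under `ρ`. -/
def PP (M : List (AC0 ι)) (d k : ℕ) (ρ : ι → Option Bool) : Prop :=
  ∀ c ∈ M, c.depth ≤ d → CT (Cst c.eval) k ρ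

theorem PP_zero (M : List (AC0 ι)) (k : ℕ) (hk : 1 ≤ k) (ρ : ι → Option Bool) : PP M 0 k ρ := by
  intro c _ hd
  cases c with
  | lit i b =>
    have h1 : CT (Cst (AC0.lit i b).eval) 1 ρ := by
      cases hi : ρ i with
      | some v =>
        exact CT.leaf _ _ ⟨if b then v else !v, fun x => by simp [AC0.eval, applyR, hi]⟩
      | none =>
        refine CT.node _ _ i hi (fun v => CT.leaf _ _ ⟨if b then v else !v, fun x => ?_⟩)
        simp [AC0.eval, applyR, setF]
    exact h1.mono hk
  | and a f => simp [AC0.depth] at hd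
  | or a f => simp [AC0.depth] at hd

theorem mk_dnf {a : ℕ} (h : Fin a → (ι → Bool) → Bool) (k : ℕ) (τ : ι → Option Bool)
    (hh : ∀ j, CT (Cst (h j)) k τ) (b : Bool) (f : (ι → Bool) → Bool)
    (hf : ∀ x, f x = b ↔ ∃ j, h j x = b) :
    ∃ L : List (Term ι), (∀ T ∈ L, T.1.card ≤ k) ∧ IsDNF b (fun y => f (applyR τ y)) L := by
  classical
  choose V hV hVc using fun j x => (hh j).cert x
  refine ⟨((Finset.univ : Finset (Fin a × (ι → Bool))).filter
    (fun q => h q.1 (applyR τ q.2) = b)).toList.map (fun q => (V q.1 q.2, q.2)), ?_, ?_⟩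
  · intro T hT
    simp only [List.mem_map] at hT
    obtain ⟨q, _, rfl⟩ := hT
    exact hV _ _
  · intro y
    rw [hf]
    constructor
    · rintro ⟨j, hj⟩
      refine ⟨(V j y, y), ?_, fun i _ => rfl⟩
      simp only [List.mem_map, Finset.mem_toList, Finset.mem_filter, Finset.mem_univ, true_and]
      exact ⟨(j, y), hj, rfl⟩
    · rintro ⟨T, hT, hs⟩
      simp only [List.mem_map, Finset.mem_toList, Finset.mem_filter, Finset.mem_univ,
        true_and] at hT
      obtain ⟨q, hq, rfl⟩ := hT
      refine ⟨q.1, ?_⟩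
      rw [hVc q.1 q.2 y hs, hq]

theorem depth_child {a : ℕ} (f : Fin a → AC0 ι) (j : Fin a) :
    (f j).depth ≤ Finset.univ.sup fun j => (f j).depth :=
  Finset.le_sup (f := fun j => (f j).depth) (Finset.mem_univ j)

theorem gate_dnf (M : List (AC0 ι)) (hM : Closed M) (d k : ℕ) (τ : ι → Option Bool)
    (hP : PP M d k τ) (c : AC0 ι) (hc : c ∈ M) (hd : c.depth = d + 1) :
    ∃ (b : Bool) (L : List (Term ι)), (∀ T ∈ L, T.1.card ≤ k) ∧
      IsDNF b (fun y => c.eval (applyR τ y)) L := by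
  cases c with
  | lit i b => simp [AC0.depth] at hd
  | and a f =>
    refine ⟨false, mk_dnf (fun j => (f j).eval) k τ (fun j => ?_) false _ (fun x => ?_)⟩
    · refine hP _ (hM a f (Or.inl hc) j) ?_
      have := depth_child f j
      simp only [AC0.depth] at hd; omega
    · simp [AC0.eval]
  | or a f =>
    refine ⟨true, mk_dnf (fun j => (f j).eval) k τ (fun j => ?_) true _ (fun x => ?_)⟩
    · refine hP _ (hM a f (Or.inr hc) j) ?_
      have := depth_child f j
      simp only [AC0.depth] at hd; omega
    · simp [AC0.eval]

theorem step_leaf (M : List (AC0 ι)) (hM : Closed M) (d k l : ℕ) (hk : 1 ≤ k) (hkl : k ≤ l)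
    (hMl : M.length ≤ 2 ^ (l + 1)) (τ : ι → Option Bool) (hP : PP M d k τ)
    (q : ℝ) (h0 : 0 ≤ q) (hq : q * (48 * k) ≤ 1) (t : ℕ) (ht : 1 ≤ t) :
    prOf (RpDensity q) (fun ρ => ¬ CT (PP M (d + 1) l) t (comp τ ρ))
      ≤ ((M.filter (fun c => c.depth = d + 1)).length : ℝ) * (1 / 2) ^ t := by
  obtain ⟨q1, _, _⟩ := num_facts k hk q h0 hq
  set N := M.filter (fun c => c.depth = d + 1) with hN
  have hNm : ∀ j : Fin N.length, N.get j ∈ M ∧ (N.get j).depth = d + 1 := by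
    intro j
    have h := List.mem_filter.1 (List.get_mem N j)
    exact ⟨h.1, of_decide_eq_true h.2⟩
  choose b L hL hg using fun j : Fin N.length =>
    gate_dnf M hM d k τ hP (N.get j) (hNm j).1 (hNm j).2
  have hlen : N.length ≤ 2 ^ (l + 1) := (List.length_filter_le _ _).trans hMl
  refine le_trans (prOf_mono (Rp_nonneg h0 q1.le) ?_)
    (multi_switch L b _ hg l k hk hlen hL q h0 hq t ht)
  intro ρ hn hc
  apply hn
  refine CT.transfer τ (fun ρ' hQ c hcM hcd => ?_) hc
  rcases Nat.lt_or_ge d c.depth with h | h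
  · have hcN : c ∈ N := by
      simp only [hN, List.mem_filter, decide_eq_true_eq]; exact ⟨hcM, by omega⟩
    obtain ⟨j, hj⟩ := List.get_of_mem hcN
    have := hQ j
    rw [hj] at this
    refine CT.transfer τ (fun ρ'' hcst => ?_) this
    obtain ⟨v, hv⟩ := hcst
    exact ⟨v, fun x => by rw [applyR_comp]; exact hv x⟩
  · exact ((hP c hcM h).mono hkl).hered (Cst.hered _) _ (le_comp _ _)

theorem step_tree (M : List (AC0 ι)) (hM : Closed M) (d k l : ℕ) (hk : 1 ≤ k) (hkl : k ≤ l)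
    (hMl : M.length ≤ 2 ^ (l + 1))
    (q : ℝ) (h0 : 0 ≤ q) (hq : q * (48 * k) ≤ 1) (t : ℕ) (ht : 1 ≤ t) (T : ℕ)
    (ρ1 : ι → Option Bool) (h : CT (PP M d k) T ρ1) :
    prOf (RpDensity q) (fun ρ => ¬ CT (PP M (d + 1) l) (T + t) (comp ρ1 ρ))
      ≤ 2 ^ T * (((M.filter (fun c => c.depth = d + 1)).length : ℝ) * (1 / 2) ^ t) := by
  obtain ⟨q1, _, _⟩ := num_facts k hk q h0 hq
  have hR := Rp_nonneg (ι := ι) h0 q1.le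
  induction h with
  | leaf T τ hP =>
    have h1 := step_leaf M hM d k l hk hkl hMl τ hP q h0 hq t ht
    refine (prOf_mono hR (P' := fun ρ => ¬ CT (PP M (d + 1) l) t (comp τ ρ)) ?_).trans
      (h1.trans ?_)
    · intro ρ hn hc
      exact hn (hc.mono (by omega))
    · exact le_mul_of_one_le_left (by positivity) (one_le_pow₀ (by norm_num))
  | node T ρ1 i hi _ ih =>
    have h1 := ih true
    have h2 := ih false
    have h3 : prOf (RpDensity q) (fun ρ => ¬ CT (PP M (d + 1) l) (T + 1 + t) (comp ρ1 ρ)) ≤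
      prOf (RpDensity q) (fun ρ =>
        ¬ CT (PP M (d + 1) l) (T + t) (comp (setF ρ1 {i} (fun _ => true)) ρ) ∨
        ¬ CT (PP M (d + 1) l) (T + t) (comp (setF ρ1 {i} (fun _ => false)) ρ)) := by
      refine prOf_mono hR ?_
      intro ρ hn
      by_contra hcon
      push Not at hcon
      apply hn
      have hb : ∀ v, CT (PP M (d + 1) l) (T + t) (comp (setF ρ1 {i} (fun _ => v)) ρ) := by
        intro v; cases v
        · exact hcon.2
        · exact hcon.1
      cases hc : ρ i with
      | none =>
        rw [show T + 1 + t = T + t + 1 by omega]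
        refine CT.node _ _ i (by simp [comp, hi, hc]) (fun v => ?_)
        convert hb v using 1
        funext j
        by_cases hji : j = i
        · subst hji; simp [setF, comp]
        · simp [setF, comp, hji]
      | some v =>
        have h5 := hb v
        have : comp (setF ρ1 {i} (fun _ => v)) ρ = comp ρ1 ρ := by
          funext j
          by_cases hji : j = i
          · subst hji; simp [setF, comp, hi, hc]
          · simp [setF, comp, hji]
        rw [this] at h5
        exact h5.mono (by omega)
    have h4 := h3.trans (prOf_or hR)
    rw [pow_succ]
    linarith

theorem stages (M : List (AC0 ι)) (hM : Closed M) (l : ℕ) (hl : 1 ≤ l)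
    (hMl : M.length ≤ 2 ^ (l + 1)) (q : ℝ) (h0 : 0 ≤ q) (hq : q * (48 * l) ≤ 1)
    (t : ℕ) (ht : 1 ≤ t) : ∀ d : ℕ,
    prOf (RpDensity (1 / 48 * q ^ d))
      (fun ρ => ¬ CT (PP M (d + 1) l) ((2 ^ (d + 1) - 1) * t) ρ) ≤
      ((M.filter (fun c => 1 ≤ c.depth ∧ c.depth ≤ d + 1)).length : ℝ) * (1 / 2) ^ t := by
  obtain ⟨q1, _, _⟩ := num_facts l hl q h0 hq
  intro d
  induction d with
  | zero =>
    have h1 := step_tree M hM 0 1 l le_rfl hl hMl (1 / 48) (by norm_num) (by norm_num) t ht 0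
      (fun _ => none) (CT.leaf _ _ (PP_zero M 1 le_rfl _))
    have e1 : ∀ ρ : ι → Option Bool, comp (fun _ => none) ρ = ρ := fun ρ => rfl
    have e2 : M.filter (fun c => decide (c.depth = 0 + 1)) =
        M.filter (fun c => decide (1 ≤ c.depth ∧ c.depth ≤ 0 + 1)) := by
      apply List.filter_congr
      intro c _
      simp only [decide_eq_decide]; omega
    simp only [e1, e2] at h1
    simpa using h1
  | succ d ih =>
    have hp0 : (0 : ℝ) ≤ 1 / 48 * q ^ d := by positivity
    have hp1 : (1 / 48 * q ^ d : ℝ) ≤ 1 := by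
      have : q ^ d ≤ 1 := pow_le_one₀ h0 q1.le
      linarith
    have hw := Rp_nonneg (ι := ι) hp0 hp1
    rw [pow_succ, ← mul_assoc, prOf_comp]
    set T := (2 ^ (d + 1) - 1) * t with hT
    have hTt : (2 ^ (d + 1 + 1) - 1) * t = T + (T + t) := by
      have h2 : 1 ≤ 2 ^ (d + 1) := Nat.one_le_two_pow
      obtain ⟨u, hu⟩ : ∃ u, 2 ^ (d + 1) = u + 1 := ⟨2 ^ (d + 1) - 1, by omega⟩
      rw [hT, pow_succ 2 (d + 1), hu]
      have : (u + 1) * 2 - 1 = 2 * u + 1 := by omega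
      rw [this]; simp only [Nat.add_sub_cancel]; ring
    rw [hTt]
    set A := ((M.filter (fun c => decide (c.depth = d + 1 + 1))).length : ℝ) * (1 / 2) ^ t with hA
    have hA0 : 0 ≤ A := by positivity
    classical
    have bound : ∀ ρ1 : ι → Option Bool,
        RpDensity (1 / 48 * q ^ d) ρ1 * prOf (RpDensity q)
          (fun ρ2 => ¬ CT (PP M (d + 1 + 1) l) (T + (T + t)) (comp ρ1 ρ2)) ≤
        (if ¬ CT (PP M (d + 1) l) T ρ1 then RpDensity (1 / 48 * q ^ d) ρ1 else 0) +
          RpDensity (1 / 48 * q ^ d) ρ1 * A := by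
      intro ρ1
      by_cases hc : CT (PP M (d + 1) l) T ρ1
      · simp only [hc, not_true_eq_false, if_false, zero_add]
        refine mul_le_mul_of_nonneg_left ?_ (hw _)
        refine (step_tree M hM (d + 1) l l hl le_rfl hMl q h0 hq (T + t) (by omega) T ρ1
          hc).trans (le_of_eq ?_)
        rw [hA, pow_add]
        have : (2 : ℝ) ^ T * (1 / 2) ^ T = 1 := by rw [← mul_pow]; norm_num
        linear_combination (((M.filter (fun c => decide (c.depth = d + 1 + 1))).length : ℝ)
          * (1 / 2) ^ t) * this
      · simp only [hc, not_false_eq_true, if_true]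
        have := prOf_le_one h0 q1.le
          (fun ρ2 => ¬ CT (PP M (d + 1 + 1) l) (T + (T + t)) (comp ρ1 ρ2))
        have h6 := mul_le_mul_of_nonneg_left this (hw ρ1)
        have h7 := mul_nonneg (hw ρ1) hA0
        linarith
    refine (Finset.sum_le_sum fun ρ1 _ => bound ρ1).trans ?_
    rw [Finset.sum_add_distrib, ← Finset.sum_mul, Rp_sum, one_mul]
    have hcount : (M.filter (fun c => decide (1 ≤ c.depth ∧ c.depth ≤ d + 1))).length +
        (M.filter (fun c => decide (c.depth = d + 1 + 1))).length =
        (M.filter (fun c => decide (1 ≤ c.depth ∧ c.depth ≤ d + 1 + 1))).length := by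
      clear * -
      induction M with
      | nil => simp
      | cons c M ih =>
        simp only [List.filter_cons, decide_eq_true_eq]
        split_ifs <;> (try simp only [List.length_cons]) <;> omega
    have hcount' := congrArg (Nat.cast (R := ℝ)) hcount
    push_cast at hcount'
    rw [← hcount', add_mul]
    refine add_le_add ?_ le_rfl
    unfold prOf at ih
    refine le_trans (le_of_eq (Finset.sum_congr rfl fun ρ _ => ?_)) ih
    by_cases hc : CT (PP M (d + 1) l) T ρ <;> simp [hc]

end MS

/-- **Corollary 3.3 (depth reduction with an arbitrary top gate).** Let `F = G(C_1,…,C_a)`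
where `G` is arbitrary and the `C_i` are depth-`d` AC⁰ circuits of total size at most
`s ≥ 2`, and let `p = (1/48)·(48·log₂ s)^{-(d-1)}`. Then for every `t ≥ 1`, the
probability over `ρ ← R_p` that `F↾ρ` is not computed by a
`(2^d·t, G∘DT_{log₂ s})`-decision tree is at most `s·2^{-t}`. -/
theorem depth_reduction_top_gate (n a d s : ℕ) (hs : 2 ≤ s)
    (G : (Fin a → Bool) → Bool) (C : Fin a → AC0 (Fin n))
    (hdepth : ∀ i, (C i).depth ≤ d) (hsize : ∑ i, (C i).size ≤ s)
    (F : (Fin n → Bool) → Bool) (hF : ∀ x, F x = G fun i => (C i).eval x)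
    (t : ℕ) (ht : 1 ≤ t) :
    prOf (RpDensity ((1 / 48 : ℝ) * (48 * Real.logb 2 (s : ℝ)) ^ (-((d : ℝ) - 1))))
      (fun ρ : Fin n → Option Bool =>
        ¬ ComputedByClassDT (2 ^ d * t)
            (fun h => ∃ D : Fin a → DTree (Fin n) Bool,
              (∀ i, ((D i).depth : ℝ) ≤ Real.logb 2 (s : ℝ)) ∧
              ∀ x, h x = G fun i => evalDT (D i) x)
            (restrictF F ρ))
      ≤ (s : ℝ) / 2 ^ t := by
  classical
  set M : List (AC0 (Fin n)) := (List.finRange a).flatMap (fun i => MS.subs (C i)) with hMdef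
  have hMem : ∀ i, C i ∈ M := by
    intro i
    simp only [hMdef, List.mem_flatMap, List.mem_finRange, true_and]
    exact ⟨i, MS.self_mem_subs _⟩
  have hM : MS.Closed M := by
    intro a' f h j
    simp only [hMdef, List.mem_flatMap, List.mem_finRange, true_and] at h ⊢
    rcases h with ⟨i, h⟩ | ⟨i, h⟩
    · exact ⟨i, MS.subs_closed _ a' f (Or.inl h) j⟩
    · exact ⟨i, MS.subs_closed _ a' f (Or.inr h) j⟩
  have hMs : M.length ≤ s := by
    refine le_trans (le_of_eq ?_) hsize
    simp only [hMdef, List.length_flatMap, MS.subs_length]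
    rw [Fin.sum_univ_def]
  set l := Nat.log 2 s with hldef
  have hl : 1 ≤ l := Nat.log_pos (by norm_num) hs
  have hsl : s ≤ 2 ^ (l + 1) := (Nat.lt_pow_succ_log_self (by norm_num) s).le
  have hlg : (l : ℝ) ≤ Real.logb 2 (s : ℝ) := by
    have := Real.natLog_le_logb s 2
    exact_mod_cast this
  have hl' : (1 : ℝ) ≤ l := by exact_mod_cast hl
  -- good restrictions give the required trees
  have good : ∀ (T : ℕ) (ρ : Fin n → Option Bool), T ≤ 2 ^ d * t → MS.CT (MS.PP M d l) T ρ →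
      ComputedByClassDT (2 ^ d * t)
            (fun h => ∃ D : Fin a → DTree (Fin n) Bool,
              (∀ i, ((D i).depth : ℝ) ≤ Real.logb 2 (s : ℝ)) ∧
              ∀ x, h x = G fun i => evalDT (D i) x)
            (restrictF F ρ) := by
    intro T ρ hT h
    refine MS.CT.toClass (fun ρ' hP => ?_) (h.mono hT)
    choose D hD hDe using fun i => (hP (C i) (hMem i) (hdepth i)).toDTree
    refine ⟨D, fun i => ?_, fun x => ?_⟩
    · have : ((D i).depth : ℝ) ≤ l := by exact_mod_cast hD i
      linarith
    · simp only [restrictF, hF, hDe]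
  rcases d with _ | d
  · have : ∀ ρ : Fin n → Option Bool, ComputedByClassDT (2 ^ 0 * t)
            (fun h => ∃ D : Fin a → DTree (Fin n) Bool,
              (∀ i, ((D i).depth : ℝ) ≤ Real.logb 2 (s : ℝ)) ∧
              ∀ x, h x = G fun i => evalDT (D i) x)
            (restrictF F ρ) := fun ρ =>
      good 0 ρ (Nat.zero_le _) (MS.CT.leaf _ _ (MS.PP_zero M l hl ρ))
    unfold prOf
    simp only [this, not_true_eq_false, if_false, Finset.sum_const_zero]
    positivity
  · set q : ℝ := (48 * Real.logb 2 (s : ℝ))⁻¹ with hqdef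
    have hLpos : 0 < 48 * Real.logb 2 (s : ℝ) := by linarith
    have hq0 : 0 ≤ q := by positivity
    have hq : q * (48 * l) ≤ 1 := by
      rw [hqdef, inv_mul_le_iff₀ hLpos]; linarith
    have hpe : (1 / 48 : ℝ) * (48 * Real.logb 2 (s : ℝ)) ^ (-(((d + 1 : ℕ) : ℝ) - 1)) =
        1 / 48 * q ^ d := by
      congr 1
      push_cast
      rw [add_sub_cancel_right, Real.rpow_neg hLpos.le, Real.rpow_natCast, hqdef, inv_pow]
    rw [hpe]
    obtain ⟨q1, _, _⟩ := MS.num_facts l hl q hq0 hq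
    have hp0 : (0 : ℝ) ≤ 1 / 48 * q ^ d := by positivity
    have hp1 : (1 / 48 * q ^ d : ℝ) ≤ 1 := by
      have : q ^ d ≤ 1 := pow_le_one₀ hq0 q1.le
      linarith
    have main := MS.stages M hM l hl (hMs.trans hsl) q hq0 hq t ht d
    refine (MS.prOf_mono (MS.Rp_nonneg hp0 hp1) (fun ρ hn hc => hn ?_)).trans (main.trans ?_)
    · rw [one_div, inv_pow, ← div_eq_mul_inv]
      have : (M.filter (fun c => decide (1 ≤ c.depth ∧ c.depth ≤ d + 1))).length ≤ s :=
        (List.length_filter_le _ _).trans hMs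
      have h' : ((M.filter (fun c => decide (1 ≤ c.depth ∧ c.depth ≤ d + 1))).length : ℝ) ≤ s := by
        exact_mod_cast this
      gcongr
    · exact good _ ρ (Nat.mul_le_mul_right t (Nat.sub_le _ _)) hc
end

section
/- (Corollary 3.5, collapse of {SYM,THR}∘AC^0 circuits under R_p.) There exists an absolute constant τ > 0 such that for every depth d ∈ ℕ and all sufficiently large n of the form n = m(k+1)r with m = r and k = ⌊0.0005·log₂ m⌋, the following holds. Let F be a Boolean function on {0,1}^n computed by a circuit of size s = n^{τ·log₂ n} whose top gate is SYM or THR fed by depth-d AC^0 circuits, and set p = (1/48)·(48·log₂ s)^{−(d−1)}. Then Pr_{ρ ← R_p}[ F↾ρ is not computed by an (m/2, C)-decision tree ] ≤ s·2^{−m/2^{d+2}}, where C is the class of SYM∘AND_{log₂ s} and THR∘AND_{log₂ s} circuits of size at most s². -/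
open Finset

namespace Collapse

set_option linter.unusedSectionVars false

variable {ι : Type}

section basics
variable [DecidableEq ι]

/-- Overwrite the restriction on `B` by the values `σ`. -/
def ovr (ρ : ι → Option Bool) (B : Finset ι) (σ : ι → Bool) : ι → Option Bool :=
  fun i => if i ∈ B then some (σ i) else ρ i

/-- Free the coordinates in `B`. -/
def uns (ρ : ι → Option Bool) (B : Finset ι) : ι → Option Bool :=
  fun i => if i ∈ B then none else ρ i

/-- `ρ` has a decision tree of depth at most `t` all of whose leaves satisfy `P`. -/
def Common (P : (ι → Option Bool) → Prop) : ℕ → (ι → Option Bool) → Prop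
  | 0, ρ => P ρ
  | t + 1, ρ => P ρ ∨ ∃ i, ρ i = none ∧ ∀ b, Common P t (Function.update ρ i (some b))

theorem Common.of_base {P : (ι → Option Bool) → Prop} {t : ℕ} {ρ : ι → Option Bool}
    (h : P ρ) : Common P t ρ := by
  cases t with
  | zero => exact h
  | succ t => exact Or.inl h

theorem Common.succ {P : (ι → Option Bool) → Prop} {t : ℕ} {ρ : ι → Option Bool}
    (h : Common P t ρ) : Common P (t + 1) ρ := by
  induction t generalizing ρ with
  | zero => exact Or.inl h
  | succ t ih =>
    rcases h with h | ⟨i, hi, h⟩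
    · exact Or.inl h
    · exact Or.inr ⟨i, hi, fun b => ih (h b)⟩

theorem Common.mono_le {P : (ι → Option Bool) → Prop} {t t' : ℕ} {ρ : ι → Option Bool}
    (h : Common P t ρ) (ht : t ≤ t') : Common P t' ρ := by
  induction ht with
  | refl => exact h
  | step _ ih => exact ih.succ

theorem not_common_ovr {P : (ι → Option Bool) → Prop} (B : Finset ι) :
    ∀ (t : ℕ) (ρ : ι → Option Bool), ¬ Common P t ρ → (∀ i ∈ B, ρ i = none) → B.card ≤ t →
      ∃ τ : ι → Bool, ¬ Common P (t - B.card) (ovr ρ B τ) := by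
  induction B using Finset.induction_on with
  | empty =>
    intro t ρ h _ _
    refine ⟨fun _ => false, ?_⟩
    have : ovr ρ ∅ (fun _ => false) = ρ := by funext i; simp [ovr]
    rw [this]; simpa using h
  | insert i B hi ih =>
    intro t ρ h hB ht
    rw [Finset.card_insert_of_notMem hi] at ht ⊢
    obtain ⟨t', rfl⟩ : ∃ t', t = t' + 1 := ⟨t - 1, by omega⟩
    have : ∃ b, ¬ Common P t' (Function.update ρ i (some b)) := by
      by_contra hcon
      push Not at hcon
      exact h (Or.inr ⟨i, hB i (Finset.mem_insert_self _ _), hcon⟩)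
    obtain ⟨b, hb⟩ := this
    obtain ⟨τ, hτ⟩ := ih t' (Function.update ρ i (some b)) hb (by
      intro j hj
      have : j ≠ i := by rintro rfl; exact hi hj
      rw [Function.update_of_ne this]
      exact hB j (Finset.mem_insert_of_mem hj)) (by omega)
    refine ⟨Function.update τ i b, ?_⟩
    have e : ovr ρ (insert i B) (Function.update τ i b) =
        ovr (Function.update ρ i (some b)) B τ := by
      funext j
      by_cases hj : j = i
      · subst hj; simp [ovr, hi]
      · simp [ovr, hj]
    rw [e]
    have : t' + 1 - (B.card + 1) = t' - B.card := by omega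
    rwa [this]

/-- The second restriction extends the first. -/
def Ext (ρ ρ' : ι → Option Bool) : Prop := ∀ i b, ρ i = some b → ρ' i = some b

/-- `f` restricted by `ρ` is constant. -/
def Cst (f : (ι → Bool) → Bool) (ρ : ι → Option Bool) : Prop :=
  ∃ b, ∀ x, f (applyR ρ x) = b

/-- Terms: a set of variables and the required values. -/
abbrev Term (ι : Type) := Finset ι × (ι → Bool)

/-- The term is not falsified by `ρ`. -/
def NF (ρ : ι → Option Bool) (T : Term ι) : Prop := ∀ v ∈ T.1, ρ v ≠ some (!T.2 v)

/-- The term is satisfied by `x`. -/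
def Sat (x : ι → Bool) (T : Term ι) : Prop := ∀ v ∈ T.1, x v = T.2 v

instance (x : ι → Bool) (T : Term ι) : Decidable (Sat x T) := by unfold Sat; infer_instance
instance (ρ : ι → Option Bool) (T : Term ι) : Decidable (NF ρ T) := by unfold NF; infer_instance

def firstNF (L : List (Term ι)) (ρ : ι → Option Bool) : Option (Term ι) :=
  L.find? fun T => decide (NF ρ T)

theorem NF.of_ext {ρ ρ' : ι → Option Bool} (h : Ext ρ ρ') {T : Term ι} (hT : NF ρ' T) :
    NF ρ T := fun v hv h1 => hT v hv (h v _ h1)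

theorem firstNF_stable {L : List (Term ι)} {ρ ρ' : ι → Option Bool} {T : Term ι}
    (h : firstNF L ρ = some T) (he : Ext ρ ρ') (hT : NF ρ' T) : firstNF L ρ' = some T := by
  unfold firstNF at *
  rw [List.find?_eq_some_iff_append] at h ⊢
  obtain ⟨_, as, bs, hL, ha⟩ := h
  refine ⟨by simpa using hT, as, bs, hL, fun a haa => ?_⟩
  have := ha a haa
  simp only [Bool.not_eq_true', decide_eq_false_iff_not] at this ⊢
  exact fun h' => this (h'.of_ext he)

/-- Possible decodings for one segment. -/
noncomputable def innerDec (L : List (Term ι)) :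
    ℕ → ℕ → (ι → Option Bool) → Multiset (Finset ι × ℕ)
  | 0, n, _ => if n = 0 then {(∅, 0)} else 0
  | u + 1, n, ρ => if n = 0 then {(∅, 0)} else
      match firstNF L ρ with
      | none => 0
      | some T => (T.1.powerset.erase ∅).val.bind fun A => A.powerset.val.bind fun U =>
          (innerDec L u (n - A.card) (ovr ρ A fun i => decide (i ∈ U))).map
            fun q => (A ∪ q.1, A.card + q.2)

theorem innerDec_card (L : List (Term ι)) (u : ℕ) : ∀ (n : ℕ) (ρ : ι → Option Bool)
    (q : Finset ι × ℕ), q ∈ innerDec L u n ρ → q.1.card ≤ q.2 := by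
  induction u with
  | zero =>
    intro n ρ q hq
    unfold innerDec at hq
    split_ifs at hq
    · simp at hq; subst hq; simp
    · simp at hq
  | succ u ih =>
    intro n ρ q hq
    unfold innerDec at hq
    split_ifs at hq
    · simp at hq; subst hq; simp
    · split at hq
      · simp at hq
      · simp only [Multiset.mem_bind, Multiset.mem_map] at hq
        obtain ⟨A, _, U, _, q', hq', rfl⟩ := hq
        have := ih _ _ _ hq'
        exact (Finset.card_union_le _ _).trans (by simpa using this)

theorem innerDec_sum (L : List (Term ι)) (k : ℕ) (hL : ∀ T ∈ L, T.1.card ≤ k) (x y : ℝ)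
    (hx : 0 ≤ x) (hy : 0 < y) (hy1 : y ≤ 1) (hxy : (1 + 2 * x / y) ^ k ≤ 2) (u : ℕ) :
    ∀ (n : ℕ) (ρ : ι → Option Bool),
      ((innerDec L u n ρ).map fun q => x ^ q.2).sum ≤ y ^ n := by
  induction u with
  | zero =>
    intro n ρ
    unfold innerDec
    split_ifs with h
    · simp [h]
    · simp; positivity
  | succ u ih =>
    intro n ρ
    unfold innerDec
    split_ifs with h
    · simp [h]
    · split
      · simp; positivity
      · rename_i T hT
        have hTL : T ∈ L := List.mem_of_find?_eq_some hT
        have hk := hL T hTL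
        simp only [Multiset.map_bind, Multiset.sum_bind, Multiset.map_map, Function.comp_def,
          pow_add]
        change (∑ A ∈ T.1.powerset.erase ∅, ∑ U ∈ A.powerset, (_ : ℝ) : ℝ) ≤ _
        calc _ ≤ ∑ A ∈ T.1.powerset.erase ∅, y ^ n * (2 * x / y) ^ A.card := by
              refine Finset.sum_le_sum fun A _ => ?_
              have h1 : ∀ U ∈ A.powerset,
                  ((innerDec L u (n - A.card) (ovr ρ A fun i => decide (i ∈ U))).map
                    fun q => x ^ A.card * x ^ q.2).sum ≤ x ^ A.card * y ^ (n - A.card) := by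
                intro U _
                rw [Multiset.sum_map_mul_left]
                exact mul_le_mul_of_nonneg_left (ih _ _) (by positivity)
              refine (Finset.sum_le_sum h1).trans ?_
              rw [Finset.sum_const, Finset.card_powerset, nsmul_eq_mul]
              have h2 : y ^ (n - A.card) * y ^ A.card ≤ y ^ n := by
                rw [← pow_add]
                exact pow_le_pow_of_le_one hy.le hy1 (by omega)
              have h3 : (2 * x / y) ^ A.card * y ^ A.card = 2 ^ A.card * x ^ A.card := by
                rw [← mul_pow, ← mul_pow]; congr 1; field_simp
              have h4 : 0 < y ^ A.card := by positivity
              push_cast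
              refine le_of_mul_le_mul_right ?_ h4
              calc _ = (2 ^ A.card * x ^ A.card) * (y ^ (n - A.card) * y ^ A.card) := by ring
                _ ≤ (2 ^ A.card * x ^ A.card) * y ^ n :=
                  mul_le_mul_of_nonneg_left h2 (by positivity)
                _ = _ := by rw [← h3]; ring
          _ = y ^ n * ((1 + 2 * x / y) ^ T.1.card - 1) := by
              rw [← Finset.mul_sum]
              congr 1
              have h5 := Finset.sum_pow_mul_eq_add_pow (2 * x / y) 1 T.1
              simp only [one_pow, mul_one] at h5
              have h6 := Finset.sum_erase_add T.1.powerset (fun A => (2 * x / y) ^ A.card)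
                (Finset.empty_mem_powerset T.1)
              simp only [Finset.card_empty, pow_zero] at h6
              rw [add_comm 1]
              linarith
          _ ≤ y ^ n * (2 - 1) := by
              refine mul_le_mul_of_nonneg_left ?_ (by positivity)
              have : (1 + 2 * x / y) ^ T.1.card ≤ (1 + 2 * x / y) ^ k :=
                pow_le_pow_right₀ (by have : 0 ≤ 2 * x / y := by positivity
                                      linarith) hk
              linarith
          _ = y ^ n := by ring

/-- Possible decodings. -/
noncomputable def outerDec {J : Type} [Fintype J] (Ls : J → List (Term ι)) (l : ℕ) :
    ℕ → ℕ → (ι → Option Bool) → Multiset ((ι → Option Bool) × ℕ)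
  | 0, t, ρ => if t = 0 then {(ρ, 0)} else 0
  | u + 1, t, ρ => if t = 0 then {(ρ, 0)} else
      (Finset.univ : Finset J).val.bind fun j => (innerDec (Ls j) l l ρ).bind fun q =>
        q.1.powerset.val.bind fun U =>
          (outerDec Ls l u (t - q.2) (ovr ρ q.1 fun i => decide (i ∈ U))).map
            fun r => (uns r.1 q.1, q.2 + r.2)

theorem outerDec_sum {J : Type} [Fintype J] (Ls : J → List (Term ι)) (l k : ℕ)
    (hL : ∀ j, ∀ T ∈ Ls j, T.1.card ≤ k) (c : ℝ) (hc : 0 ≤ c)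
    (hck : (1 + 16 * c) ^ k ≤ 2) (hJ : Fintype.card J ≤ 2 ^ l) (u : ℕ) :
    ∀ (t : ℕ) (ρ : ι → Option Bool),
      ((outerDec Ls l u t ρ).map fun q => c ^ q.2).sum ≤ (1 / 2 : ℝ) ^ t := by
  induction u with
  | zero =>
    intro t ρ
    unfold outerDec
    split_ifs with h
    · simp [h]
    · simp
  | succ u ih =>
    intro t ρ
    unfold outerDec
    split_ifs with h
    · simp [h]
    · simp only [Multiset.map_bind, Multiset.sum_bind, Multiset.map_map, Function.comp_def,
          pow_add]
      change ∑ j : J, _ ≤ _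
      have key : ∀ j : J, ((innerDec (Ls j) l l ρ).map fun q => ∑ U ∈ q.1.powerset,
          ((outerDec Ls l u (t - q.2) (ovr ρ q.1 fun i => decide (i ∈ U))).map
            fun r => c ^ q.2 * c ^ r.2).sum).sum ≤ (1 / 2 : ℝ) ^ t * (1 / 2 : ℝ) ^ l := by
        intro j
        calc _ ≤ ((innerDec (Ls j) l l ρ).map fun q => (1 / 2 : ℝ) ^ t * (4 * c) ^ q.2).sum := by
              refine Multiset.sum_map_le_sum_map _ _ fun q hq => ?_
              have hcard := innerDec_card _ _ _ _ _ hq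
              have h1 : ∀ U ∈ q.1.powerset,
                  ((outerDec Ls l u (t - q.2) (ovr ρ q.1 fun i => decide (i ∈ U))).map
                    fun r => c ^ q.2 * c ^ r.2).sum ≤ c ^ q.2 * (1 / 2 : ℝ) ^ (t - q.2) := by
                intro U _
                rw [Multiset.sum_map_mul_left]
                exact mul_le_mul_of_nonneg_left (ih _ _) (by positivity)
              refine (Finset.sum_le_sum h1).trans ?_
              rw [Finset.sum_const, Finset.card_powerset, nsmul_eq_mul]
              push_cast
              have h2 : (1 / 2 : ℝ) ^ (t - q.2) ≤ (1 / 2 : ℝ) ^ t * 2 ^ q.2 := by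
                have : (1 / 2 : ℝ) ^ (t - q.2) * (1 / 2) ^ q.2 ≤ (1 / 2 : ℝ) ^ t := by
                  rw [← pow_add]
                  exact pow_le_pow_of_le_one (by norm_num) (by norm_num) (by omega)
                calc (1 / 2 : ℝ) ^ (t - q.2)
                    = ((1 / 2 : ℝ) ^ (t - q.2) * (1 / 2) ^ q.2) * 2 ^ q.2 := by
                      rw [mul_assoc, ← mul_pow]; norm_num
                  _ ≤ _ := mul_le_mul_of_nonneg_right this (by positivity)
              have h3 : (2 : ℝ) ^ q.1.card ≤ 2 ^ q.2 :=
                pow_le_pow_right₀ (by norm_num) hcard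
              calc (2 : ℝ) ^ q.1.card * (c ^ q.2 * (1 / 2 : ℝ) ^ (t - q.2))
                  ≤ 2 ^ q.2 * (c ^ q.2 * ((1 / 2 : ℝ) ^ t * 2 ^ q.2)) := by gcongr
                _ = _ := by
                  have : (4 : ℝ) = 2 * 2 := by norm_num
                  rw [this, mul_pow, mul_pow]; ring
          _ = (1 / 2 : ℝ) ^ t * ((innerDec (Ls j) l l ρ).map fun q => (4 * c) ^ q.2).sum := by
              rw [Multiset.sum_map_mul_left]
          _ ≤ _ := by
              refine mul_le_mul_of_nonneg_left ?_ (by positivity)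
              refine innerDec_sum (Ls j) k (hL j) (4 * c) (1 / 2) (by positivity) (by norm_num)
                (by norm_num) ?_ _ _ _
              convert hck using 2
              ring
      refine (Finset.sum_le_sum fun j _ => key j).trans ?_
      rw [Finset.sum_const, nsmul_eq_mul, Finset.card_univ]
      have h1 : (Fintype.card J : ℝ) ≤ 2 ^ l := by exact_mod_cast hJ
      calc (Fintype.card J : ℝ) * ((1 / 2 : ℝ) ^ t * (1 / 2 : ℝ) ^ l)
          ≤ 2 ^ l * ((1 / 2 : ℝ) ^ t * (1 / 2 : ℝ) ^ l) := by gcongr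
        _ = (2 * (1 / 2)) ^ l * (1 / 2 : ℝ) ^ t := by rw [mul_pow]; ring
        _ = _ := by norm_num

end basics

section claims
variable [DecidableEq ι]

theorem ovr_filter (ρ : ι → Option Bool) (B : Finset ι) (τ : ι → Bool) :
    ovr ρ B (fun i => decide (i ∈ B.filter fun i => τ i = true)) = ovr ρ B τ := by
  funext i
  by_cases h : i ∈ B <;> simp [ovr, h]

theorem inner_claim (f : (ι → Bool) → Bool) (L : List (Term ι)) (sgn : Bool)
    (hf : ∀ x, f x = xor sgn (decide (∃ T ∈ L, Sat x T))) (u : ℕ) :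
    ∀ (n : ℕ) (ρ : ι → Option Bool), n ≤ u → (n = 0 ∨ ¬ Common (Cst f) (n - 1) ρ) →
      ∃ (B : Finset ι) (σ : ι → Bool), (∀ i ∈ B, ρ i = none) ∧ n ≤ B.card ∧
        ∀ ρ', Ext (ovr ρ B σ) ρ' → (B, B.card) ∈ innerDec L u n ρ' := by
  induction u with
  | zero =>
    intro n ρ hn _
    have : n = 0 := by omega
    subst this
    exact ⟨∅, fun _ => false, by simp, by simp, fun ρ' _ => by simp [innerDec]⟩
  | succ u ih =>
    intro n ρ hn h
    by_cases hn0 : n = 0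
    · subst hn0
      exact ⟨∅, fun _ => false, by simp, by simp, fun ρ' _ => by simp [innerDec]⟩
    have hC := h.resolve_left hn0
    have hnc : ¬ Cst f ρ := fun hh => hC (Common.of_base hh)
    -- the first non-falsified term
    obtain ⟨T, hT⟩ : ∃ T, firstNF L ρ = some T := by
      by_contra hcon
      push Not at hcon
      have hnone : firstNF L ρ = none := by
        cases hx : firstNF L ρ with
        | none => rfl
        | some T => exact absurd hx (hcon T)
      unfold firstNF at hnone
      rw [List.find?_eq_none] at hnone
      apply hnc
      refine ⟨xor sgn false, fun x => ?_⟩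
      rw [hf]
      congr 1
      simp only [decide_eq_false_iff_not]
      rintro ⟨T, hTL, hS⟩
      apply hnone T hTL
      simp only [decide_eq_true_eq]
      intro v hv hval
      have := hS v hv
      simp [applyR, hval] at this
    have hTL : T ∈ L := List.mem_of_find?_eq_some hT
    have hTNF : NF ρ T := by
      have := List.find?_some hT
      simpa using this
    set A := T.1.filter fun v => ρ v = none with hA
    have hAfree : ∀ i ∈ A, ρ i = none := fun i hi => (Finset.mem_filter.mp hi).2
    have hAT : A ⊆ T.1 := Finset.filter_subset _ _
    have hfix : ∀ v ∈ T.1, v ∉ A → ρ v = some (T.2 v) := by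
      intro v hv hvA
      have h1 := hTNF v hv
      have h2 : ρ v ≠ none := fun h' => hvA (Finset.mem_filter.mpr ⟨hv, h'⟩)
      cases hρ : ρ v with
      | none => exact absurd hρ h2
      | some b =>
        rw [hρ] at h1
        cases b <;> cases hb : T.2 v <;> simp_all
    have hAne : A ≠ ∅ := by
      intro hAe
      apply hnc
      refine ⟨xor sgn true, fun x => ?_⟩
      rw [hf]
      congr 1
      simp only [decide_eq_true_eq]
      refine ⟨T, hTL, fun v hv => ?_⟩
      have := hfix v hv (by simp [hAe])
      simp [applyR, this]
    have hApos : 1 ≤ A.card := Finset.card_pos.mpr (Finset.nonempty_iff_ne_empty.mpr hAne)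
    -- the answers on A
    obtain ⟨τ, hτ⟩ : ∃ τ : ι → Bool,
        n - A.card = 0 ∨ ¬ Common (Cst f) (n - A.card - 1) (ovr ρ A τ) := by
      by_cases hc : A.card ≤ n - 1
      · obtain ⟨τ, hτ⟩ := not_common_ovr A (n - 1) ρ hC hAfree hc
        refine ⟨τ, Or.inr ?_⟩
        have : n - A.card - 1 = n - 1 - A.card := by omega
        rwa [this]
      · exact ⟨fun _ => false, Or.inl (by omega)⟩
    obtain ⟨B', σ', hB'free, hB'card, hB'⟩ := ih (n - A.card) (ovr ρ A τ) (by omega) hτ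
    have hdisj : ∀ i ∈ B', i ∉ A := by
      intro i hi hiA
      have := hB'free i hi
      simp [ovr, hiA] at this
    have hdisj' : Disjoint A B' := by
      rw [Finset.disjoint_left]
      exact fun i hiA hi => hdisj i hi hiA
    refine ⟨A ∪ B', fun i => if i ∈ A then T.2 i else σ' i, ?_, ?_, ?_⟩
    · intro i hi
      rcases Finset.mem_union.mp hi with hi | hi
      · exact hAfree i hi
      · have h1 := hB'free i hi
        simpa [ovr, hdisj i hi] using h1
    · rw [Finset.card_union_of_disjoint hdisj']; omega
    · intro ρ' hext
      have hA' : ∀ i ∈ A, ρ' i = some (T.2 i) := by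
        intro i hi
        apply hext
        simp [ovr, hi]
      have hext0 : Ext ρ ρ' := by
        intro i b hb
        apply hext
        have h1 : i ∉ A := fun hi => by simp [hAfree i hi] at hb
        have h2 : i ∉ B' := fun hi => by
          have := hB'free i hi
          simp [ovr, h1, hb] at this
        simp [ovr, h1, h2, hb]
      have hNF' : NF ρ' T := by
        intro v hv hcon
        have : ρ' v = some (T.2 v) := by
          by_cases hvA : v ∈ A
          · exact hA' v hvA
          · exact hext0 _ _ (hfix v hv hvA)
        rw [this] at hcon
        simp at hcon
      have hfirst := firstNF_stable hT hext0 hNF'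
      have hmem := hB' (ovr ρ' A τ) (by
        intro i b hb
        by_cases hiA : i ∈ A
        · have : i ∉ B' := fun hi => hdisj i hi hiA
          simp [ovr, hiA, this] at hb ⊢
          exact hb
        · have : ρ' i = some b := by
            apply hext
            by_cases hiB : i ∈ B'
            · simp [ovr, hiA, hiB] at hb ⊢; exact hb
            · simp [ovr, hiA, hiB] at hb ⊢; exact hb
          simp [ovr, hiA, this])
      unfold innerDec
      rw [if_neg hn0, hfirst]
      simp only [Multiset.mem_bind, Multiset.mem_map]
      refine ⟨A, ?_, A.filter fun i => τ i = true, ?_, (B', B'.card), ?_, ?_⟩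
      · rw [Finset.mem_val]
        exact Finset.mem_erase.mpr ⟨hAne, Finset.mem_powerset.mpr hAT⟩
      · rw [Finset.mem_val]
        exact Finset.mem_powerset.mpr (Finset.filter_subset _ _)
      · rw [ovr_filter]; exact hmem
      · simp [Finset.card_union_of_disjoint hdisj']

theorem outer_claim {J : Type} [Fintype J] (f : J → (ι → Bool) → Bool)
    (Ls : J → List (Term ι)) (sgn : J → Bool)
    (hf : ∀ j x, f j x = xor (sgn j) (decide (∃ T ∈ Ls j, Sat x T))) (w u : ℕ) :
    ∀ (t : ℕ) (ρ : ι → Option Bool), t ≤ u →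
      (t = 0 ∨ ¬ Common (fun ρ => ∀ j, Common (Cst (f j)) w ρ) t ρ) →
      ∃ (B : Finset ι) (σ : ι → Bool), (∀ i ∈ B, ρ i = none) ∧
        (ρ, B.card) ∈ outerDec Ls (w + 1) u t (ovr ρ B σ) := by
  induction u with
  | zero =>
    intro t ρ ht _
    have : t = 0 := by omega
    subst this
    refine ⟨∅, fun _ => false, by simp, ?_⟩
    have : ovr ρ ∅ (fun _ => false) = ρ := by funext i; simp [ovr]
    simp [outerDec, this]
  | succ u ih =>
    intro t ρ ht h
    by_cases ht0 : t = 0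
    · subst ht0
      refine ⟨∅, fun _ => false, by simp, ?_⟩
      have : ovr ρ ∅ (fun _ => false) = ρ := by funext i; simp [ovr]
      simp [outerDec, this]
    have hC := h.resolve_left ht0
    have hnc : ¬ ∀ j, Common (Cst (f j)) w ρ := fun hh => hC (Common.of_base hh)
    push Not at hnc
    obtain ⟨j, hj⟩ := hnc
    obtain ⟨B, σ, hBfree, hBcard, hB⟩ := inner_claim (f j) (Ls j) (sgn j) (hf j) (w + 1)
      (w + 1) ρ le_rfl (Or.inr (by simpa using hj))
    obtain ⟨τ, hτ⟩ : ∃ τ : ι → Bool, t - B.card = 0 ∨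
        ¬ Common (fun ρ => ∀ j, Common (Cst (f j)) w ρ) (t - B.card) (ovr ρ B τ) := by
      by_cases hc : B.card ≤ t
      · obtain ⟨τ, hτ⟩ := not_common_ovr B t ρ hC hBfree hc
        exact ⟨τ, Or.inr hτ⟩
      · exact ⟨fun _ => false, Or.inl (by omega)⟩
    obtain ⟨B', σ', hB'free, hB'⟩ := ih (t - B.card) (ovr ρ B τ) (by omega) hτ
    have hdisj : ∀ i ∈ B', i ∉ B := by
      intro i hi hiA
      have := hB'free i hi
      simp [ovr, hiA] at this
    have hdisj' : Disjoint B B' := by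
      rw [Finset.disjoint_left]
      exact fun i hiA hi => hdisj i hi hiA
    refine ⟨B ∪ B', fun i => if i ∈ B then σ i else σ' i, ?_, ?_⟩
    · intro i hi
      rcases Finset.mem_union.mp hi with hi | hi
      · exact hBfree i hi
      · have h1 := hB'free i hi
        simpa [ovr, hdisj i hi] using h1
    · set ρ' := ovr ρ (B ∪ B') (fun i => if i ∈ B then σ i else σ' i) with hρ'
      have hext : Ext (ovr ρ B σ) ρ' := by
        intro i b hb
        by_cases hiB : i ∈ B
        · simp [hρ', ovr, hiB] at hb ⊢; exact hb
        · have : i ∉ B' := fun hi => by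
            have := hB'free i hi
            simp [ovr, hiB] at this hb
            simp [this] at hb
          simp [hρ', ovr, hiB, this] at hb ⊢; exact hb
      have hin := hB ρ' hext
      have e1 : ovr ρ' B τ = ovr (ovr ρ B τ) B' σ' := by
        funext i
        by_cases hiB : i ∈ B
        · have : i ∉ B' := fun hi => hdisj i hi hiB
          simp [ovr, hiB, this]
        · by_cases hi' : i ∈ B' <;> simp [hρ', ovr, hiB, hi']
      have e2 : uns (ovr ρ B τ) B = ρ := by
        funext i
        by_cases hiB : i ∈ B
        · simp [uns, hiB, hBfree i hiB]
        · simp [uns, ovr, hiB]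
      unfold outerDec
      rw [if_neg ht0]
      simp only [Multiset.mem_bind, Multiset.mem_map]
      refine ⟨j, by simp, (B, B.card), hin, B.filter fun i => τ i = true, ?_,
        (ovr ρ B τ, B'.card), ?_, ?_⟩
      · rw [Finset.mem_val]
        exact Finset.mem_powerset.mpr (Finset.filter_subset _ _)
      · rw [ovr_filter, e1]; exact hB'
      · simp [Finset.card_union_of_disjoint hdisj', e2]

variable [Fintype ι]

theorem Rp_nonneg {p : ℝ} (h0 : 0 ≤ p) (h1 : p ≤ 1) (ρ : ι → Option Bool) :
    0 ≤ RpDensity p ρ := by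
  unfold RpDensity
  refine Finset.prod_nonneg fun i _ => ?_
  cases ρ i with
  | none => exact h0
  | some b => simp; linarith

theorem sum_prod_option (g : ι → Option Bool → ℝ) :
    ∑ ρ : ι → Option Bool, ∏ i, g i (ρ i) = ∏ i, ∑ a, g i a := by
  rw [Finset.prod_univ_sum, Fintype.piFinset_univ]

theorem Rp_sum (p : ℝ) : ∑ ρ : ι → Option Bool, RpDensity p ρ = 1 := by
  unfold RpDensity
  rw [sum_prod_option (fun _ a => a.elim p (fun _ => (1 - p) / 2))]
  refine Finset.prod_eq_one fun i _ => ?_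
  rw [Fintype.sum_option]
  simp
  ring

theorem Rp_ovr {p : ℝ} (h0 : 0 < p) (h1 : p < 1) (ρ : ι → Option Bool) (B : Finset ι)
    (σ : ι → Bool) (hB : ∀ i ∈ B, ρ i = none) :
    RpDensity p ρ = (2 * p / (1 - p)) ^ B.card * RpDensity p (ovr ρ B σ) := by
  unfold RpDensity
  have e : (2 * p / (1 - p)) ^ B.card = ∏ i, if i ∈ B then 2 * p / (1 - p) else 1 := by
    rw [Finset.prod_ite_mem, Finset.univ_inter, Finset.prod_const]
  rw [e, ← Finset.prod_mul_distrib]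
  refine Finset.prod_congr rfl fun i _ => ?_
  have : 1 - p ≠ 0 := by linarith
  by_cases hi : i ∈ B
  · simp only [hB i hi, hi, ovr, if_true, Option.elim]
    field_simp
  · simp [hi, ovr]

theorem fiber_sum {α : Type} [Fintype α] [DecidableEq α] (D : Multiset (α × ℕ)) (c : ℝ) :
    ∑ a, (D.map fun r => if r.1 = a then c ^ r.2 else 0).sum = (D.map fun r => c ^ r.2).sum := by
  induction D using Multiset.induction_on with
  | empty => simp
  | cons r D ih =>
    simp only [Multiset.map_cons, Multiset.sum_cons, Finset.sum_add_distrib, ih]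
    simp

theorem multi_switching {J : Type} [Fintype J] (f : J → (ι → Bool) → Bool) (k w t : ℕ)
    (hf : ∀ j, ∃ (L : List (Term ι)) (sgn : Bool), (∀ T ∈ L, T.1.card ≤ k) ∧
      ∀ x, f j x = xor sgn (decide (∃ T ∈ L, Sat x T)))
    (hJ : Fintype.card J ≤ 2 ^ (w + 1)) (p : ℝ) (hp0 : 0 < p) (hp1 : p ≤ 1 / 48)
    (hpk : p * k ≤ 1 / 48) :
    prOf (RpDensity p) (fun ρ => ¬ Common (fun ρ => ∀ j, Common (Cst (f j)) w ρ) t ρ)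
      ≤ (1 / 2 : ℝ) ^ t := by
  classical
  choose Ls sgn hLk hfx using hf
  set c := 2 * p / (1 - p) with hc
  have h1p : 0 < 1 - p := by linarith
  have hc0 : 0 ≤ c := by positivity
  have hck : (1 + 16 * c) ^ k ≤ 2 := by
    have h1 : 1 + 16 * c ≤ Real.exp (16 * c) := by
      have := Real.add_one_le_exp (16 * c); linarith
    have h2 : (1 + 16 * c) ^ k ≤ Real.exp (16 * c) ^ k :=
      pow_le_pow_left₀ (by positivity) h1 k
    rw [← Real.exp_nat_mul] at h2
    have h3 : (k : ℝ) * (16 * c) ≤ 32 / 47 := by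
      rw [hc]
      have : (k : ℝ) * (16 * (2 * p / (1 - p))) = 32 * (p * k) / (1 - p) := by ring
      rw [this, div_le_div_iff₀ h1p (by norm_num)]
      nlinarith
    have h4 : (k : ℝ) * (16 * c) ≤ Real.log 2 := by
      have := Real.log_two_gt_d9
      linarith
    calc _ ≤ _ := h2
      _ ≤ Real.exp (Real.log 2) := Real.exp_le_exp.mpr h4
      _ = 2 := Real.exp_log (by norm_num)
  set D := outerDec Ls (w + 1) t t with hD
  have hDsum : ∀ ρ', ((D ρ').map fun q => c ^ q.2).sum ≤ (1 / 2 : ℝ) ^ t :=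
    outerDec_sum Ls (w + 1) k hLk c hc0 hck hJ t t
  have hR : ∀ ρ : ι → Option Bool, 0 ≤ RpDensity p ρ :=
    Rp_nonneg hp0.le (by linarith)
  have hnn : ∀ ρ ρ', 0 ≤ ((D ρ').map fun r => if r.1 = ρ then c ^ r.2 else 0).sum := by
    intro ρ ρ'
    refine Multiset.sum_nonneg fun x hx => ?_
    obtain ⟨r, _, rfl⟩ := Multiset.mem_map.mp hx
    split_ifs <;> positivity
  unfold prOf
  calc _ ≤ ∑ ρ, ∑ ρ', RpDensity p ρ' *
          ((D ρ').map fun r => if r.1 = ρ then c ^ r.2 else 0).sum := by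
        refine Finset.sum_le_sum fun ρ _ => ?_
        split_ifs with hbad
        · obtain ⟨B, σ, hBf, hmem⟩ := outer_claim f Ls sgn hfx w t t ρ le_rfl (Or.inr hbad)
          refine le_trans ?_ (Finset.single_le_sum (f := fun ρ' => RpDensity p ρ' *
            ((D ρ').map fun r => if r.1 = ρ then c ^ r.2 else 0).sum)
            (fun ρ' _ => mul_nonneg (hR _) (hnn _ _)) (Finset.mem_univ (ovr ρ B σ)))
          rw [Rp_ovr hp0 (by linarith) ρ B σ hBf, mul_comm]
          refine mul_le_mul_of_nonneg_left ?_ (hR _)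
          refine Multiset.single_le_sum ?_ _ ?_
          · intro x hx
            obtain ⟨r, _, rfl⟩ := Multiset.mem_map.mp hx
            split_ifs <;> positivity
          · exact Multiset.mem_map.mpr ⟨_, hmem, by simp [hc]⟩
        · exact Finset.sum_nonneg fun ρ' _ => mul_nonneg (hR _) (hnn _ _)
    _ = ∑ ρ', RpDensity p ρ' * ((D ρ').map fun r => c ^ r.2).sum := by
        rw [Finset.sum_comm]
        refine Finset.sum_congr rfl fun ρ' _ => ?_
        rw [← Finset.mul_sum, fiber_sum]
    _ ≤ ∑ ρ', RpDensity p ρ' * (1 / 2 : ℝ) ^ t :=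
        Finset.sum_le_sum fun ρ' _ => mul_le_mul_of_nonneg_left (hDsum ρ') (hR _)
    _ = _ := by rw [← Finset.sum_mul, Rp_sum, one_mul]

end claims

section layers
variable [DecidableEq ι]

/-- Composition of restrictions. -/
def comp (ρ₁ ρ₂ : ι → Option Bool) : ι → Option Bool := fun i => (ρ₁ i).or (ρ₂ i)

theorem applyR_comp (ρ₁ ρ₂ : ι → Option Bool) (x : ι → Bool) :
    applyR (comp ρ₁ ρ₂) x = applyR ρ₁ (applyR ρ₂ x) := by
  funext i
  simp only [applyR, comp]
  cases ρ₁ i <;> simp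

theorem Common.imp {P Q : (ι → Option Bool) → Prop} (h : ∀ ρ, P ρ → Q ρ) {t : ℕ}
    {ρ : ι → Option Bool} (hc : Common P t ρ) : Common Q t ρ := by
  induction t generalizing ρ with
  | zero => exact h _ hc
  | succ t ih =>
    rcases hc with hc | ⟨i, hi, hc⟩
    · exact Or.inl (h _ hc)
    · exact Or.inr ⟨i, hi, fun b => ih (hc b)⟩

theorem common_comp {Q : (ι → Option Bool) → Prop} (ρ₀ : ι → Option Bool) {t : ℕ}
    {ρ : ι → Option Bool} (hc : Common (fun ρ => Q (comp ρ₀ ρ)) t ρ) :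
    Common Q t (comp ρ₀ ρ) := by
  induction t generalizing ρ with
  | zero => exact hc
  | succ t ih =>
    rcases hc with hc | ⟨i, hi, hc⟩
    · exact Or.inl hc
    · cases h0 : ρ₀ i with
      | none =>
        refine Or.inr ⟨i, by simp [comp, h0, hi], fun b => ?_⟩
        have e : Function.update (comp ρ₀ ρ) i (some b) =
            comp ρ₀ (Function.update ρ i (some b)) := by
          funext j
          by_cases hj : j = i
          · subst hj; simp [comp, h0]
          · simp [comp, hj]
        rw [e]
        exact ih (hc b)
      | some c =>
        have e : comp ρ₀ ρ = comp ρ₀ (Function.update ρ i (some c)) := by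
          funext j
          by_cases hj : j = i
          · subst hj; simp [comp, h0]
          · simp [comp, hj]
        rw [e]
        exact (ih (hc c)).succ

theorem prOf_mono {α : Type} [Fintype α] {R : α → ℝ} (hR : ∀ a, 0 ≤ R a) {E E' : α → Prop}
    (h : ∀ a, E a → E' a) : prOf R E ≤ prOf R E' := by
  unfold prOf
  refine Finset.sum_le_sum fun a _ => ?_
  split_ifs with h1 h2
  · exact le_rfl
  · exact absurd (h a h1) h2
  · exact hR a
  · exact le_rfl

theorem prOf_or {α : Type} [Fintype α] {R : α → ℝ} (hR : ∀ a, 0 ≤ R a) (E E' : α → Prop) :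
    prOf R (fun a => E a ∨ E' a) ≤ prOf R E + prOf R E' := by
  unfold prOf
  rw [← Finset.sum_add_distrib]
  refine Finset.sum_le_sum fun a _ => ?_
  have := hR a
  by_cases h1 : E a <;> by_cases h2 : E' a <;> simp [h1, h2, this]

variable [Fintype ι]

theorem prOf_le_one {p : ℝ} (h0 : 0 ≤ p) (h1 : p ≤ 1) (E : (ι → Option Bool) → Prop) :
    prOf (RpDensity p) E ≤ 1 := by
  rw [← Rp_sum (ι := ι) p]
  unfold prOf
  refine Finset.sum_le_sum fun a _ => ?_
  split_ifs
  · exact le_rfl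
  · exact Rp_nonneg h0 h1 a

theorem comp_pr (p q : ℝ) (E : (ι → Option Bool) → Prop) :
    prOf (RpDensity (p * q)) E =
      ∑ ρ₁ : ι → Option Bool, RpDensity p ρ₁ *
        prOf (RpDensity q) (fun ρ₂ => E (comp ρ₁ ρ₂)) := by
  classical
  have key : ∀ ρ : ι → Option Bool, RpDensity (p * q) ρ =
      ∑ ρ₁ : ι → Option Bool, ∑ ρ₂ : ι → Option Bool,
        if comp ρ₁ ρ₂ = ρ then RpDensity p ρ₁ * RpDensity q ρ₂ else 0 := by
    intro ρ
    have h1 : ∀ ρ₁ ρ₂ : ι → Option Bool,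
        (if comp ρ₁ ρ₂ = ρ then RpDensity p ρ₁ * RpDensity q ρ₂ else 0) =
        ∏ i, if (ρ₁ i).or (ρ₂ i) = ρ i then
          (ρ₁ i).elim p (fun _ => (1 - p) / 2) * (ρ₂ i).elim q (fun _ => (1 - q) / 2) else 0 := by
      intro ρ₁ ρ₂
      split_ifs with h
      · unfold RpDensity
        rw [← Finset.prod_mul_distrib]
        refine Finset.prod_congr rfl fun i _ => ?_
        rw [if_pos]
        rw [← h]; rfl
      · obtain ⟨i, hi⟩ := Function.ne_iff.mp h
        rw [Finset.prod_eq_zero (Finset.mem_univ i)]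
        rw [if_neg]
        exact hi
    simp only [h1]
    have h2 : ∀ ρ₁ : ι → Option Bool, (∑ ρ₂ : ι → Option Bool,
        ∏ i, if (ρ₁ i).or (ρ₂ i) = ρ i then
          (ρ₁ i).elim p (fun _ => (1 - p) / 2) * (ρ₂ i).elim q (fun _ => (1 - q) / 2) else 0) =
        ∏ i, ∑ a : Option Bool, if (ρ₁ i).or a = ρ i then
          (ρ₁ i).elim p (fun _ => (1 - p) / 2) * a.elim q (fun _ => (1 - q) / 2) else 0 := by
      intro ρ₁
      exact sum_prod_option (fun i a => if (ρ₁ i).or a = ρ i then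
          (ρ₁ i).elim p (fun _ => (1 - p) / 2) * a.elim q (fun _ => (1 - q) / 2) else 0)
    simp only [h2]
    rw [sum_prod_option (fun i a' => ∑ a : Option Bool, if a'.or a = ρ i then
          a'.elim p (fun _ => (1 - p) / 2) * a.elim q (fun _ => (1 - q) / 2) else 0)]
    unfold RpDensity
    refine Finset.prod_congr rfl fun i _ => ?_
    simp only [Fintype.sum_option, Fintype.sum_bool]
    cases ρ i with
    | none => simp
    | some b => cases b <;> simp <;> ring
  unfold prOf
  simp only [key, Finset.mul_sum]
  calc _ = ∑ ρ : ι → Option Bool, ∑ ρ₁ : ι → Option Bool, ∑ ρ₂ : ι → Option Bool,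
        (if comp ρ₁ ρ₂ = ρ then (if E ρ then RpDensity p ρ₁ * RpDensity q ρ₂ else 0) else 0) := by
        refine Finset.sum_congr rfl fun ρ _ => ?_
        by_cases hE : E ρ
        · simp [hE]
        · simp [hE]
    _ = ∑ ρ₁ : ι → Option Bool, ∑ ρ₂ : ι → Option Bool, ∑ ρ : ι → Option Bool,
        (if comp ρ₁ ρ₂ = ρ then (if E ρ then RpDensity p ρ₁ * RpDensity q ρ₂ else 0) else 0) := by
        rw [Finset.sum_comm]
        refine Finset.sum_congr rfl fun ρ₁ _ => ?_
        rw [Finset.sum_comm]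
    _ = _ := by
        refine Finset.sum_congr rfl fun ρ₁ _ => Finset.sum_congr rfl fun ρ₂ _ => ?_
        simp

theorem chain_step {P Q : (ι → Option Bool) → Prop} {q ε : ℝ} (hq0 : 0 ≤ q) (hq1 : q ≤ 1)
    (hε : 0 ≤ ε) (t₂ : ℕ)
    (hstep : ∀ ρ₀, P ρ₀ → prOf (RpDensity q) (fun ρ => ¬ Common Q t₂ (comp ρ₀ ρ)) ≤ ε) :
    ∀ (t₁ : ℕ) (ρ₀ : ι → Option Bool), Common P t₁ ρ₀ →
      prOf (RpDensity q) (fun ρ => ¬ Common Q (t₁ + t₂) (comp ρ₀ ρ)) ≤ 2 ^ t₁ * ε := by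
  have hR : ∀ ρ : ι → Option Bool, 0 ≤ RpDensity q ρ := Rp_nonneg hq0 hq1
  have hbase : ∀ (t₁ : ℕ) (ρ₀ : ι → Option Bool), P ρ₀ →
      prOf (RpDensity q) (fun ρ => ¬ Common Q (t₁ + t₂) (comp ρ₀ ρ)) ≤ 2 ^ t₁ * ε := by
    intro t₁ ρ₀ hP
    refine (prOf_mono hR (E' := fun ρ => ¬ Common Q t₂ (comp ρ₀ ρ)) ?_).trans
      ((hstep ρ₀ hP).trans ?_)
    · intro ρ h h'
      exact h (h'.mono_le (by omega))
    · have : (1 : ℝ) ≤ 2 ^ t₁ := one_le_pow₀ (by norm_num)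
      nlinarith
  intro t₁
  induction t₁ with
  | zero => intro ρ₀ h; exact hbase 0 ρ₀ h
  | succ t₁ ih =>
    intro ρ₀ h
    rcases h with h | ⟨i, hi, h⟩
    · exact hbase _ ρ₀ h
    · have hf := ih _ (h false)
      have ht := ih _ (h true)
      calc _ ≤ prOf (RpDensity q) (fun ρ =>
            (¬ Common Q (t₁ + t₂) (comp (Function.update ρ₀ i (some false)) ρ)) ∨
            (¬ Common Q (t₁ + t₂) (comp (Function.update ρ₀ i (some true)) ρ))) := by
            refine prOf_mono hR fun ρ hbad => ?_
            by_contra hcon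
            push Not at hcon
            apply hbad
            have hb : ∀ b, Common Q (t₁ + t₂) (comp (Function.update ρ₀ i (some b)) ρ) := by
              intro b; cases b
              · exact hcon.1
              · exact hcon.2
            have e1 : t₁ + 1 + t₂ = (t₁ + t₂) + 1 := by omega
            rw [e1]
            cases hρ : ρ i with
            | none =>
              refine Or.inr ⟨i, by simp [comp, hi, hρ], fun b => ?_⟩
              have e : Function.update (comp ρ₀ ρ) i (some b) =
                  comp (Function.update ρ₀ i (some b)) ρ := by
                funext j
                by_cases hj : j = i
                · subst hj; simp [comp]
                · simp [comp, hj]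
              rw [e]; exact hb b
            | some c =>
              have e : comp ρ₀ ρ = comp (Function.update ρ₀ i (some c)) ρ := by
                funext j
                by_cases hj : j = i
                · subst hj; simp [comp, hi, hρ]
                · simp [comp, hj]
              rw [e]; exact (hb c).succ
        _ ≤ _ := prOf_or hR _ _
        _ ≤ 2 ^ t₁ * ε + 2 ^ t₁ * ε := add_le_add hf ht
        _ = _ := by ring

end layers

section dnf
variable [DecidableEq ι]

theorem term_list (f : (ι → Bool) → Bool) (k : ℕ) : ∀ ρ : ι → Option Bool,
    Common (Cst f) k ρ → ∃ L : List (Term ι), L.length ≤ 2 ^ k ∧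
      (∀ T ∈ L, T.1.card ≤ k ∧ ∀ v ∈ T.1, ρ v = none) ∧
      ∀ x, (L.map fun T => if Sat x T then 1 else 0).sum =
        if f (applyR ρ x) = true then 1 else 0 := by
  have hbase : ∀ (k : ℕ) (ρ : ι → Option Bool), Cst f ρ →
      ∃ L : List (Term ι), L.length ≤ 2 ^ k ∧
      (∀ T ∈ L, T.1.card ≤ k ∧ ∀ v ∈ T.1, ρ v = none) ∧
      ∀ x, (L.map fun T => if Sat x T then 1 else 0).sum =
        if f (applyR ρ x) = true then 1 else 0 := by
    rintro k ρ ⟨b, hb⟩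
    cases b
    · exact ⟨[], by simp, by simp, by simp [hb]⟩
    · refine ⟨[(∅, fun _ => false)], by simp [Nat.one_le_two_pow], by simp, by simp [hb, Sat]⟩
  induction k with
  | zero => intro ρ h; exact hbase 0 ρ h
  | succ k ih =>
    intro ρ h
    rcases h with h | ⟨i, hi, h⟩
    · exact hbase _ ρ h
    · choose L hlen hT hsum using fun b => ih _ (h b)
      let ext : Bool → Term ι → Term ι := fun b T => (insert i T.1, Function.update T.2 i b)
      have hinot : ∀ b, ∀ T ∈ L b, i ∉ T.1 := by
        intro b T hTL hiT
        have := (hT b T hTL).2 i hiT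
        simp at this
      have hSat : ∀ b, ∀ T ∈ L b, ∀ x, Sat x (ext b T) ↔ x i = b ∧ Sat x T := by
        intro b T hTL x
        have hni := hinot b T hTL
        constructor
        · intro hs
          refine ⟨by simpa [ext] using hs i (by simp [ext]), fun v hv => ?_⟩
          have hvi : v ≠ i := by rintro rfl; exact hni hv
          simpa [ext, hvi] using hs v (by simp [ext, hv])
        · rintro ⟨hxi, hs⟩ v hv
          by_cases hvi : v = i
          · subst hvi; simpa [ext] using hxi
          · simp only [ext, Finset.mem_insert, hvi, false_or] at hv
            simpa [ext, hvi] using hs v hv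
      have hsum' : ∀ b x, ((L b).map fun T => if Sat x (ext b T) then 1 else 0).sum =
          if x i = b ∧ f (applyR ρ x) = true then 1 else 0 := by
        intro b x
        by_cases hxi : x i = b
        · have e : applyR (Function.update ρ i (some b)) x = applyR ρ x := by
            funext j
            by_cases hj : j = i
            · subst hj; simp [applyR, hi, hxi]
            · simp [applyR, hj]
          have := hsum b x
          rw [e] at this
          simp only [hxi, true_and]
          rw [← this]
          congr 1
          refine List.map_congr_left fun T hTL => ?_
          simp only [hSat b T hTL x, hxi, true_and]
        · simp only [hxi, false_and, if_false]
          refine List.sum_eq_zero fun y hy => ?_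
          obtain ⟨T, hTL, rfl⟩ := List.mem_map.mp hy
          simp [hSat b T hTL x, hxi]
      refine ⟨(L false).map (ext false) ++ (L true).map (ext true), ?_, ?_, ?_⟩
      · have h1 := hlen false
        have h2 := hlen true
        simp only [List.length_append, List.length_map, pow_succ]
        omega
      · intro T hTm
        have : ∃ b, ∃ T' ∈ L b, ext b T' = T := by
          rcases List.mem_append.mp hTm with h' | h'
          · exact ⟨false, by simpa using h'⟩
          · exact ⟨true, by simpa using h'⟩
        obtain ⟨b, T', hT', rfl⟩ := this
        have h1 := hT b T' hT'
        refine ⟨(Finset.card_insert_le _ _).trans (by omega), fun v hv => ?_⟩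
        by_cases hvi : v = i
        · subst hvi; exact hi
        · simp only [ext, Finset.mem_insert, hvi, false_or] at hv
          have := h1.2 v hv
          simpa [hvi] using this
      · intro x
        rw [List.map_append, List.sum_append, List.map_map, List.map_map]
        have h1 := hsum' false x
        have h2 := hsum' true x
        simp only [Function.comp_def]
        rw [h1, h2]
        cases hx : x i <;> simp

theorem dnf_of_common (f : (ι → Bool) → Bool) (k : ℕ) (ρ : ι → Option Bool)
    (h : Common (Cst f) k ρ) : ∃ L : List (Term ι), (∀ T ∈ L, T.1.card ≤ k) ∧
      ∀ x, f (applyR ρ x) = true ↔ ∃ T ∈ L, Sat x T := by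
  obtain ⟨L, _, hT, hs⟩ := term_list f k ρ h
  refine ⟨L, fun T hTL => (hT T hTL).1, fun x => ?_⟩
  have := hs x
  constructor
  · intro hf
    rw [if_pos hf] at this
    by_contra hcon
    push Not at hcon
    have h0 : (L.map fun T => if Sat x T then 1 else 0).sum = 0 := by
      refine List.sum_eq_zero fun y hy => ?_
      obtain ⟨T, hTL, rfl⟩ := List.mem_map.mp hy
      simp [hcon T hTL]
    omega
  · rintro ⟨T, hTL, hS⟩
    by_contra hf
    rw [if_neg hf, List.sum_eq_zero_iff] at this
    have := this 1 (List.mem_map.mpr ⟨T, hTL, by simp [hS]⟩)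
    omega

end dnf

section circuits

/-- All subcircuits, with multiplicity. -/
def subs : AC0 ι → List (AC0 ι)
  | .lit i b => [.lit i b]
  | .and a f => .and a f :: (List.finRange a).flatMap fun j => subs (f j)
  | .or a f => .or a f :: (List.finRange a).flatMap fun j => subs (f j)

theorem subs_length (C : AC0 ι) : (subs C).length = C.size := by
  induction C with
  | lit i b => simp [subs, AC0.size]
  | and a f ih =>
    simp only [subs, AC0.size, List.length_cons, List.length_flatMap, ih, Fin.sum_univ_def]
    omega
  | or a f ih =>
    simp only [subs, AC0.size, List.length_cons, List.length_flatMap, ih, Fin.sum_univ_def]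
    omega

theorem self_mem_subs (C : AC0 ι) : C ∈ subs C := by
  cases C <;> simp [subs]

/-- A list of circuits closed under taking children. -/
def Closed (G : List (AC0 ι)) : Prop :=
  (∀ a f, AC0.and a f ∈ G → ∀ j, f j ∈ G) ∧ (∀ a f, AC0.or a f ∈ G → ∀ j, f j ∈ G)

theorem closed_flatMap {a : ℕ} (g : Fin a → List (AC0 ι)) (h : ∀ j, Closed (g j)) :
    Closed ((List.finRange a).flatMap g) := by
  constructor
  · intro a' f hm j
    obtain ⟨i, hi, hm⟩ := List.mem_flatMap.mp hm
    exact List.mem_flatMap.mpr ⟨i, hi, (h i).1 _ _ hm j⟩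
  · intro a' f hm j
    obtain ⟨i, hi, hm⟩ := List.mem_flatMap.mp hm
    exact List.mem_flatMap.mpr ⟨i, hi, (h i).2 _ _ hm j⟩

theorem subs_closed (C : AC0 ι) : Closed (subs C) := by
  induction C with
  | lit i b => constructor <;> simp [subs]
  | and a f ih =>
    have hc := closed_flatMap (fun j => subs (f j)) ih
    constructor
    · intro a' f' hm j
      simp only [subs, List.mem_cons] at hm ⊢
      right
      rcases hm with hm | hm
      · cases hm
        exact List.mem_flatMap.mpr ⟨j, by simp, self_mem_subs _⟩
      · exact hc.1 _ _ hm j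
    · intro a' f' hm j
      simp only [subs, List.mem_cons] at hm ⊢
      right
      rcases hm with hm | hm
      · cases hm
      · exact hc.2 _ _ hm j
  | or a f ih =>
    have hc := closed_flatMap (fun j => subs (f j)) ih
    constructor
    · intro a' f' hm j
      simp only [subs, List.mem_cons] at hm ⊢
      right
      rcases hm with hm | hm
      · cases hm
      · exact hc.1 _ _ hm j
    · intro a' f' hm j
      simp only [subs, List.mem_cons] at hm ⊢
      right
      rcases hm with hm | hm
      · cases hm
        exact List.mem_flatMap.mpr ⟨j, by simp, self_mem_subs _⟩
      · exact hc.2 _ _ hm j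

variable [DecidableEq ι]

/-- All subcircuits of depth at most `h` have decision trees of depth `k` under `ρ`. -/
def Lay (G : List (AC0 ι)) (k h : ℕ) (ρ : ι → Option Bool) : Prop :=
  ∀ D ∈ G, D.depth ≤ h → Common (Cst D.eval) k ρ

theorem lay_zero (G : List (AC0 ι)) (k : ℕ) (hk : 1 ≤ k) (ρ : ι → Option Bool) :
    Lay G k 0 ρ := by
  intro D _ hd
  refine Common.mono_le (t := 1) ?_ hk
  cases D with
  | lit i b =>
    cases hρ : ρ i with
    | some c => exact Or.inl ⟨if b then c else !c, fun x => by simp [AC0.eval, applyR, hρ]⟩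
    | none =>
      refine Or.inr ⟨i, hρ, fun c => ⟨if b then c else !c, fun x => by simp [AC0.eval, applyR]⟩⟩
  | and a f => simp [AC0.depth] at hd
  | or a f => simp [AC0.depth] at hd

theorem gate_dnf {G : List (AC0 ι)} (hG : Closed G) {k h : ℕ} {ρ₀ : ι → Option Bool}
    (hL : Lay G k h ρ₀) (D : AC0 ι) (hD : D ∈ G) (hd : D.depth ≤ h + 1) :
    ∃ (L : List (Term ι)) (sgn : Bool), (∀ T ∈ L, T.1.card ≤ k) ∧
      ∀ x, D.eval (applyR ρ₀ x) = xor sgn (decide (∃ T ∈ L, Sat x T)) := by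
  cases D with
  | lit i b =>
    obtain ⟨L, hLk, hx⟩ := dnf_of_common _ k ρ₀ (hL _ hD (by simp [AC0.depth]))
    refine ⟨L, false, hLk, fun x => ?_⟩
    rw [Bool.false_xor, Bool.eq_iff_iff, hx x, decide_eq_true_iff]
  | or a f =>
    have hch : ∀ j, (f j).depth ≤ h := by
      intro j
      simp only [AC0.depth] at hd
      have := Finset.le_sup (f := fun j => (f j).depth) (Finset.mem_univ j)
      omega
    choose L hLk hx using fun j => dnf_of_common _ k ρ₀ (hL (f j) (hG.2 _ _ hD j) (hch j))
    refine ⟨(List.finRange a).flatMap L, false, ?_, fun x => ?_⟩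
    · intro T hT
      obtain ⟨j, _, hT⟩ := List.mem_flatMap.mp hT
      exact hLk j T hT
    · rw [Bool.false_xor, Bool.eq_iff_iff, decide_eq_true_iff]
      simp only [AC0.eval, decide_eq_true_iff, hx, List.mem_flatMap, List.mem_finRange, true_and]
      constructor
      · rintro ⟨j, T, hT, hS⟩; exact ⟨T, ⟨j, hT⟩, hS⟩
      · rintro ⟨T, ⟨j, hT⟩, hS⟩; exact ⟨j, T, hT, hS⟩
  | and a f =>
    have hch : ∀ j, (f j).depth ≤ h := by
      intro j
      simp only [AC0.depth] at hd
      have := Finset.le_sup (f := fun j => (f j).depth) (Finset.mem_univ j)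
      omega
    have hneg : ∀ j, Common (Cst fun x => !(f j).eval x) k ρ₀ := by
      intro j
      refine Common.imp ?_ (hL (f j) (hG.1 _ _ hD j) (hch j))
      rintro ρ ⟨b, hb⟩
      exact ⟨!b, fun x => by simp [hb]⟩
    choose L hLk hx using fun j => dnf_of_common _ k ρ₀ (hneg j)
    refine ⟨(List.finRange a).flatMap L, true, ?_, fun x => ?_⟩
    · intro T hT
      obtain ⟨j, _, hT⟩ := List.mem_flatMap.mp hT
      exact hLk j T hT
    · rw [Bool.true_xor, Bool.eq_iff_iff]
      simp only [AC0.eval, Bool.not_eq_true', decide_eq_true_iff, decide_eq_false_iff_not,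
        List.mem_flatMap, List.mem_finRange, true_and]
      constructor
      · rintro hall ⟨T, ⟨j, hT⟩, hS⟩
        have := (hx j x).mpr ⟨T, hT, hS⟩
        simp [hall j] at this
      · intro hno j
        by_contra hcon
        obtain ⟨T, hT, hS⟩ := (hx j x).mp (by simpa using hcon)
        exact hno ⟨T, ⟨j, hT⟩, hS⟩

variable [Fintype ι]

theorem layer_step {G : List (AC0 ι)} (hG : Closed G) {k w h t : ℕ}
    (hlen : G.length ≤ 2 ^ (w + 1)) {p : ℝ} (hp0 : 0 < p) (hp1 : p ≤ 1 / 48)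
    (hpk : p * k ≤ 1 / 48) (ρ₀ : ι → Option Bool) (hL : Lay G k h ρ₀) :
    prOf (RpDensity p) (fun ρ => ¬ Common (Lay G w (h + 1)) t (comp ρ₀ ρ)) ≤ (1 / 2 : ℝ) ^ t := by
  classical
  let J := {j : Fin G.length // (G.get j).depth ≤ h + 1}
  have hJ : Fintype.card J ≤ 2 ^ (w + 1) := by
    refine (Fintype.card_subtype_le _).trans ?_
    simpa using hlen
  refine le_trans ?_ (multi_switching (J := J) (fun j x => (G.get j.1).eval (applyR ρ₀ x)) k w t
    (fun j => gate_dnf hG hL _ (List.get_mem _ _) j.2) hJ p hp0 hp1 hpk)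
  refine prOf_mono (Rp_nonneg hp0.le (by linarith)) fun ρ hbad hgood => hbad ?_
  refine common_comp ρ₀ (hgood.imp ?_)
  intro ρ' h' D hD hd
  obtain ⟨j, rfl⟩ := List.get_of_mem hD
  refine common_comp ρ₀ ((h' ⟨j, hd⟩).imp ?_)
  rintro ρ'' ⟨b, hb⟩
  exact ⟨b, fun x => by rw [applyR_comp]; exact hb x⟩

theorem comp_none (ρ : ι → Option Bool) : comp (fun _ => none) ρ = ρ := by
  funext i; simp [comp]

theorem chain {G : List (AC0 ι)} (hG : Closed G) {w : ℕ} (hlen : G.length ≤ 2 ^ (w + 1))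
    {q : ℝ} (hq0 : 0 < q) (hq1 : q ≤ 1 / 48) (hqw : q * w ≤ 1 / 48) (t : ℕ) (h : ℕ) :
    prOf (RpDensity ((1 / 48 : ℝ) * q ^ h))
      (fun ρ : ι → Option Bool => ¬ Common (Lay G w (h + 1)) ((2 ^ (h + 1) - 1) * t) ρ)
      ≤ (h + 1) * (1 / 2 : ℝ) ^ t := by
  induction h with
  | zero =>
    have := layer_step (t := t) hG hlen (p := 1 / 48) (by norm_num) (by norm_num) (k := 1)
      (by norm_num) (fun _ => none) (lay_zero G 1 le_rfl _)
    simp only [comp_none] at this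
    simpa using this
  | succ h ih =>
    have hqle : q ≤ 1 := by linarith
    have hp0 : 0 ≤ (1 / 48 : ℝ) * q ^ h := by positivity
    have hp1 : (1 / 48 : ℝ) * q ^ h ≤ 1 := by
      have : q ^ h ≤ 1 := pow_le_one₀ hq0.le hqle
      linarith
    rw [pow_succ, ← mul_assoc, comp_pr]
    set T := (2 ^ (h + 1) - 1) * t with hT
    have hstep : ∀ ρ₀ : ι → Option Bool, Common (Lay G w (h + 1)) T ρ₀ →
        prOf (RpDensity q) (fun ρ => ¬ Common (Lay G w (h + 1 + 1))
          ((2 ^ (h + 1 + 1) - 1) * t) (comp ρ₀ ρ)) ≤ (1 / 2 : ℝ) ^ t := by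
      intro ρ₀ hc
      have h1 := chain_step (P := Lay G w (h + 1)) (Q := Lay G w (h + 1 + 1)) hq0.le hqle
        (ε := (1 / 2 : ℝ) ^ (T + t)) (by positivity) (T + t)
        (fun ρ₀ hP => layer_step hG hlen hq0 hq1 hqw ρ₀ hP) T ρ₀ hc
      have e : T + (T + t) = (2 ^ (h + 1 + 1) - 1) * t := by
        have h2 : 2 ^ (h + 1 + 1) - 1 = 2 * (2 ^ (h + 1) - 1) + 1 := by
          have : 1 ≤ 2 ^ (h + 1) := Nat.one_le_two_pow
          rw [pow_succ 2 (h + 1)]; omega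
        rw [h2, hT]; ring
      rw [e] at h1
      refine h1.trans (le_of_eq ?_)
      rw [pow_add, ← mul_assoc, ← mul_pow]; norm_num
    have hR : ∀ ρ : ι → Option Bool, 0 ≤ RpDensity ((1 / 48 : ℝ) * q ^ h) ρ := Rp_nonneg hp0 hp1
    classical
    calc _ ≤ ∑ ρ₁ : ι → Option Bool, ((if ¬ Common (Lay G w (h + 1)) T ρ₁ then
            RpDensity ((1 / 48 : ℝ) * q ^ h) ρ₁ else 0) +
            RpDensity ((1 / 48 : ℝ) * q ^ h) ρ₁ * (1 / 2 : ℝ) ^ t) := by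
          refine Finset.sum_le_sum fun ρ₁ _ => ?_
          by_cases hc : Common (Lay G w (h + 1)) T ρ₁
          · simp only [hc, not_true_eq_false, if_false, zero_add]
            exact mul_le_mul_of_nonneg_left (hstep ρ₁ hc) (hR _)
          · simp only [hc, not_false_eq_true, if_true]
            have h1 := prOf_le_one hq0.le hqle (fun ρ => ¬ Common (Lay G w (h + 1 + 1))
              ((2 ^ (h + 1 + 1) - 1) * t) (comp ρ₁ ρ))
            have h2 := mul_le_mul_of_nonneg_left h1 (hR ρ₁)
            have h3 : 0 ≤ RpDensity ((1 / 48 : ℝ) * q ^ h) ρ₁ * (1 / 2 : ℝ) ^ t :=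
              mul_nonneg (hR _) (by positivity)
            linarith
      _ ≤ (h + 1) * (1 / 2 : ℝ) ^ t + (1 / 2 : ℝ) ^ t := by
          rw [Finset.sum_add_distrib, ← Finset.sum_mul, Rp_sum, one_mul]
          refine add_le_add ?_ le_rfl
          refine le_trans (le_of_eq ?_) ih
          unfold prOf
          refine Finset.sum_congr rfl fun ρ _ => ?_
          congr
      _ = _ := by push_cast; ring

end circuits

section leaves
variable [DecidableEq ι]

theorem classDT_of_common {Cl : ((ι → Bool) → Bool) → Prop} {F : (ι → Bool) → Bool}
    {Q : (ι → Option Bool) → Prop} (hQ : ∀ ρ, Q ρ → Cl (restrictF F ρ)) (t : ℕ) :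
    ∀ ρ, Common Q t ρ → ComputedByClassDT t Cl (restrictF F ρ) := by
  have hbase : ∀ t ρ, Q ρ → ComputedByClassDT t Cl (restrictF F ρ) := fun t ρ h =>
    ⟨.leaf (restrictF F ρ), by simp [DTree.depth], by simpa [DTree.leaves] using hQ ρ h,
      fun x => rfl⟩
  induction t with
  | zero => intro ρ h; exact hbase 0 ρ h
  | succ t ih =>
    intro ρ h
    rcases h with h | ⟨i, hi, h⟩
    · exact hbase _ ρ h
    · obtain ⟨T0, hd0, hl0, he0⟩ := ih _ (h false)
      obtain ⟨T1, hd1, hl1, he1⟩ := ih _ (h true)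
      refine ⟨.node i T0 T1, by simp only [DTree.depth]; omega, ?_, ?_⟩
      · intro g hg
        simp only [DTree.leaves, List.mem_append] at hg
        rcases hg with hg | hg
        · exact hl0 g hg
        · exact hl1 g hg
      · intro x
        have e : restrictF F ρ x = restrictF F (Function.update ρ i (some (x i))) x := by
          unfold restrictF
          congr 1
          funext j
          by_cases hj : j = i
          · subst hj; simp [applyR, hi]
          · simp [applyR, hj]
        simp only [DTree.evalWith]
        cases hx : x i
        · rw [e, hx, he0 x]; simp
        · rw [e, hx, he1 x]; simp

theorem expand {a w : ℕ} (C : Fin a → AC0 ι) (ρ : ι → Option Bool)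
    (h : ∀ i, Common (Cst (C i).eval) w ρ) :
    ∃ (N : ℕ) (own : Fin N → Fin a) (T : Fin N → List (ι × Bool)), N ≤ a * 2 ^ w ∧
      (∀ j, (T j).length ≤ w) ∧ ∀ (W : Fin a → ℝ) (x : ι → Bool),
        (∑ j, if ((T j).all fun l => x l.1 == l.2) = true then W (own j) else 0) =
        ∑ i, if (C i).eval (applyR ρ x) = true then W i else 0 := by
  choose L hlen hT hs using fun i => term_list (C i).eval w ρ (h i)
  let e : (Σ i : Fin a, Fin (L i).length) ≃ Fin (∑ i, (L i).length) := finSigmaFinEquiv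
  let toL : Term ι → List (ι × Bool) := fun T => T.1.toList.map fun v => (v, T.2 v)
  have hall : ∀ (T : Term ι) (x : ι → Bool),
      ((toL T).all fun l => x l.1 == l.2) = true ↔ Sat x T := by
    intro T x
    simp [toL, Sat]
  refine ⟨∑ i, (L i).length, fun j => (e.symm j).1,
    fun j => toL ((L (e.symm j).1).get (e.symm j).2), ?_, ?_, ?_⟩
  · refine (Finset.sum_le_sum fun i _ => hlen i).trans ?_
    simp
  · intro j
    simp only [toL, List.length_map, Finset.length_toList]
    exact (hT _ _ (List.get_mem _ _)).1
  · intro W x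
    simp only [hall]
    refine (e.symm.sum_comp (fun s : (Σ i : Fin a, Fin (L i).length) =>
      if Sat x ((L s.1).get s.2) then W s.1 else 0)).trans ?_
    rw [Fintype.sum_sigma]
    refine Finset.sum_congr rfl fun i _ => ?_
    have h1 := hs i x
    have h2 : (∑ j : Fin (L i).length, if Sat x ((L i).get j) then (1 : ℕ) else 0) =
        if (C i).eval (applyR ρ x) = true then 1 else 0 := by
      rw [← h1, Fin.sum_univ_def]
      congr 1
      conv_rhs => rw [← List.map_get_finRange (L i)]
      rw [List.map_map]
      rfl
    have h3 : (∑ j : Fin (L i).length, if Sat x ((L i).get j) then W i else 0) =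
        ((∑ j : Fin (L i).length, if Sat x ((L i).get j) then (1 : ℕ) else 0 : ℕ) : ℝ) * W i := by
      push_cast
      rw [Finset.sum_mul]
      refine Finset.sum_congr rfl fun j _ => ?_
      split_ifs <;> simp
    rw [h3, h2]
    split_ifs <;> simp

theorem leaf_sym {a w : ℕ} (g : (Fin a → Bool) → Bool) (C : Fin a → AC0 ι) (hg : IsSymFun g)
    (F : (ι → Bool) → Bool) (hF : ∀ x, F x = g fun i => (C i).eval x) (S kb : ℝ)
    (hS : (a : ℝ) * 2 ^ w ≤ S) (hw : (w : ℝ) ≤ kb) (ρ : ι → Option Bool)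
    (h : ∀ i, Common (Cst (C i).eval) w ρ) : IsSymAnd S kb (restrictF F ρ) := by
  obtain ⟨φ, hφ⟩ := hg
  obtain ⟨N, own, T, hN, hT, hs⟩ := expand C ρ h
  refine ⟨N, fun y => φ (Finset.univ.filter fun i => y i = true).card, T, ⟨φ, fun _ => rfl⟩,
    ?_, ?_, ?_⟩
  · have : (N : ℝ) ≤ ((a * 2 ^ w : ℕ) : ℝ) := by exact_mod_cast hN
    push_cast at this
    linarith
  · intro i
    have : ((T i).length : ℝ) ≤ w := by exact_mod_cast hT i
    linarith
  · intro x
    have h1 := hs (fun _ => 1) x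
    rw [restrictF, hF, hφ]
    congr 1
    rw [Finset.card_filter, Finset.card_filter]
    have h2 : ((∑ i, if (C i).eval (applyR ρ x) = true then 1 else 0 : ℕ) : ℝ) =
        ((∑ j, if ((T j).all fun l => x l.1 == l.2) = true then 1 else 0 : ℕ) : ℝ) := by
      push_cast
      exact h1.symm
    exact_mod_cast h2

theorem leaf_thr {a w : ℕ} (g : (Fin a → Bool) → Bool) (C : Fin a → AC0 ι) (hg : IsThrFun g)
    (F : (ι → Bool) → Bool) (hF : ∀ x, F x = g fun i => (C i).eval x) (S kb : ℝ)
    (hS : (a : ℝ) * 2 ^ w ≤ S) (hw : (w : ℝ) ≤ kb) (ρ : ι → Option Bool)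
    (h : ∀ i, Common (Cst (C i).eval) w ρ) : IsThrAnd S kb (restrictF F ρ) := by
  obtain ⟨W, θ, hφ⟩ := hg
  obtain ⟨N, own, T, hN, hT, hs⟩ := expand C ρ h
  refine ⟨N, fun y => decide (θ ≤ ∑ i, if y i = true then W (own i) else 0), T,
    ⟨fun j => W (own j), θ, fun _ => rfl⟩, ?_, ?_, ?_⟩
  · have : (N : ℝ) ≤ ((a * 2 ^ w : ℕ) : ℝ) := by exact_mod_cast hN
    push_cast at this
    linarith
  · intro i
    have : ((T i).length : ℝ) ≤ w := by exact_mod_cast hT i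
    linarith
  · intro x
    rw [restrictF, hF, hφ, ← hs W x]

theorem size_pos (C : AC0 ι) : 1 ≤ C.size := by
  cases C <;> simp [AC0.size]

end leaves

section final
variable [DecidableEq ι] [Fintype ι]

/-- The circuit part: once the subcircuits are shallow, the event holds. -/
theorem leaf_data {s : ℝ} {d w : ℕ} (hw1 : 2 ^ w ≤ s) (hw2 : s < 2 ^ (w + 1))
    {kb : ℝ} (hwk : (w : ℝ) ≤ kb) {F : (ι → Bool) → Bool}
    (hF : SymOnAC0 s d F ∨ ThrOnAC0 s d F) :
    ∃ G : List (AC0 ι), Closed G ∧ G.length ≤ 2 ^ (w + 1) ∧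
      ∀ ρ, Lay G w d ρ → (IsSymAnd (s ^ 2) kb (restrictF F ρ) ∨
        IsThrAnd (s ^ 2) kb (restrictF F ρ)) := by
  have key : ∀ (a : ℕ) (C : Fin a → AC0 ι), (∀ i, (C i).depth ≤ d) →
      (((1 + ∑ i, (C i).size : ℕ) : ℝ) ≤ s) →
      ∃ G : List (AC0 ι), Closed G ∧ G.length ≤ 2 ^ (w + 1) ∧ (a : ℝ) * 2 ^ w ≤ s ^ 2 ∧
        ∀ ρ, Lay G w d ρ → ∀ i, Common (Cst (C i).eval) w ρ := by
    intro a C hd hs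
    refine ⟨(List.finRange a).flatMap fun i => subs (C i),
      closed_flatMap _ fun j => subs_closed _, ?_, ?_, ?_⟩
    · have h1 : ((List.finRange a).flatMap fun i => subs (C i)).length = ∑ i, (C i).size := by
        rw [List.length_flatMap, Fin.sum_univ_def]
        simp only [subs_length]
      rw [h1]
      have h2 : ((1 + ∑ i, (C i).size : ℕ) : ℝ) < ((2 ^ (w + 1) : ℕ) : ℝ) := by
        push_cast at hs ⊢
        linarith
      have h3 : 1 + ∑ i, (C i).size < 2 ^ (w + 1) := by exact_mod_cast h2
      omega
    · have h1 : a ≤ ∑ i, (C i).size := by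
        calc a = ∑ _i : Fin a, 1 := by simp
          _ ≤ _ := Finset.sum_le_sum fun i _ => size_pos (C i)
      have h2 : (a : ℝ) ≤ ((1 + ∑ i, (C i).size : ℕ) : ℝ) := by
        exact_mod_cast (by omega : a ≤ 1 + ∑ i, (C i).size)
      have h3 : (a : ℝ) ≤ s := h2.trans hs
      have h4 : (0 : ℝ) ≤ a := Nat.cast_nonneg a
      calc (a : ℝ) * 2 ^ w ≤ s * s := mul_le_mul h3 hw1 (by positivity) (by linarith)
        _ = s ^ 2 := by ring
    · intro ρ hL i
      exact hL _ (List.mem_flatMap.mpr ⟨i, List.mem_finRange i, self_mem_subs _⟩) (hd i)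
  rcases hF with ⟨a, g, C, hg, hd, hs, he⟩ | ⟨a, g, C, hg, hd, hs, he⟩
  · obtain ⟨G, hG, hl, hS, hc⟩ := key a C hd hs
    exact ⟨G, hG, hl, fun ρ hL => Or.inl (leaf_sym g C hg F he _ _ hS hwk ρ (hc ρ hL))⟩
  · obtain ⟨G, hG, hl, hS, hc⟩ := key a C hd hs
    exact ⟨G, hG, hl, fun ρ hL => Or.inr (leaf_thr g C hg F he _ _ hS hwk ρ (hc ρ hL))⟩

theorem collapse_core {s : ℝ} {d m : ℕ} (hs2 : 2 ≤ s) (hds : (d : ℝ) ≤ s)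
    (hm : 2 ^ (d + 2) ≤ m) {p : ℝ}
    (hp : p = (1 / 48 : ℝ) * (48 * Real.logb 2 s) ^ (-((d : ℝ) - 1)))
    {F : (ι → Bool) → Bool} (hF : SymOnAC0 s d F ∨ ThrOnAC0 s d F) :
    prOf (RpDensity p) (fun ρ : ι → Option Bool =>
      ¬ ComputedByClassDT (m / 2)
          (fun f => IsSymAnd (s ^ 2) (Real.logb 2 s) f ∨ IsThrAnd (s ^ 2) (Real.logb 2 s) f)
          (restrictF F ρ))
      ≤ s * (2 : ℝ) ^ (-((m : ℝ) / 2 ^ (d + 2))) := by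
  have hs0 : 0 < s := by linarith
  set L := Real.logb 2 s with hL
  have hsL : (2 : ℝ) ^ L = s := Real.rpow_logb (by norm_num) (by norm_num) hs0
  have hL1 : 1 ≤ L := by
    rw [hL, Real.le_logb_iff_rpow_le (by norm_num) hs0]
    simpa using hs2
  set w := ⌊L⌋₊ with hw
  have hwL : (w : ℝ) ≤ L := Nat.floor_le (by linarith)
  have hLw : L < w + 1 := Nat.lt_floor_add_one L
  have hw1 : 1 ≤ w := Nat.le_floor (by simpa using hL1)
  have hw1' : (2 : ℝ) ^ w ≤ s := by
    rw [← hsL, ← Real.rpow_natCast]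
    exact Real.rpow_le_rpow_of_exponent_le (by norm_num) hwL
  have hw2 : s < (2 : ℝ) ^ (w + 1) := by
    rw [← hsL, ← Real.rpow_natCast]
    refine Real.rpow_lt_rpow_of_exponent_lt (by norm_num) ?_
    push_cast
    exact hLw
  obtain ⟨G, hG, hlen, hleaf⟩ := leaf_data hw1' hw2 hwL hF
  have hrhs : 0 ≤ s * (2 : ℝ) ^ (-((m : ℝ) / 2 ^ (d + 2))) := by positivity
  have hDT : ∀ t ρ, Common (Lay G w d) t ρ → ComputedByClassDT t
      (fun f => IsSymAnd (s ^ 2) L f ∨ IsThrAnd (s ^ 2) L f) (restrictF F ρ) :=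
    fun t => classDT_of_common (F := F)
      (Cl := fun f => IsSymAnd (s ^ 2) L f ∨ IsThrAnd (s ^ 2) L f) hleaf t
  rcases d with _ | h
  · refine le_trans (le_of_eq ?_) hrhs
    unfold prOf
    refine Finset.sum_eq_zero fun ρ _ => ?_
    rw [if_neg]
    exact not_not.mpr (hDT _ ρ (Common.of_base (lay_zero G w hw1 ρ)))
  · set q : ℝ := 1 / (48 * L) with hq
    have hq0 : 0 < q := by positivity
    have hq1 : q ≤ 1 / 48 := by
      rw [hq]
      exact one_div_le_one_div_of_le (by norm_num) (by linarith)
    have hqw : q * w ≤ 1 / 48 := by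
      rw [hq, div_mul_eq_mul_div, one_mul, div_le_div_iff₀ (by positivity) (by norm_num)]
      linarith
    have hpq : p = (1 / 48 : ℝ) * q ^ h := by
      rw [hp, hq]
      congr 1
      have : -(((h + 1 : ℕ) : ℝ) - 1) = -(h : ℝ) := by push_cast; ring
      rw [this, Real.rpow_neg (by positivity), Real.rpow_natCast, one_div, inv_pow]
    set t := m / 2 ^ (h + 1 + 2) + 1 with ht
    have htm : (2 ^ (h + 1) - 1) * t ≤ m / 2 := by
      have h1 : m / 2 ^ (h + 1 + 2) * 2 ^ (h + 1 + 2) ≤ m := Nat.div_mul_le_self _ _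
      have h2 : (2 ^ (h + 1) - 1) * t ≤ 2 ^ (h + 1) * t := Nat.mul_le_mul_right _ (Nat.sub_le _ _)
      refine h2.trans ?_
      rw [Nat.le_div_iff_mul_le (by norm_num)]
      have h3 : (2 : ℕ) ^ (h + 1 + 2) = 4 * 2 ^ (h + 1) := by ring
      rw [ht]
      generalize m / 2 ^ (h + 1 + 2) = z at h1 ⊢
      rw [h3] at h1 hm
      nlinarith
    have hqh : q ^ h ≤ 1 := pow_le_one₀ hq0.le (by linarith)
    have hp0 : 0 ≤ (1 / 48 : ℝ) * q ^ h := by positivity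
    rw [hpq]
    refine (prOf_mono (Rp_nonneg hp0 (by linarith)) (fun ρ hρ hc =>
      hρ (hDT _ ρ (Common.mono_le hc htm)))).trans
      ((chain hG hlen hq0 hq1 hqw t h).trans ?_)
    have h1 : (1 / 2 : ℝ) ^ t ≤ (2 : ℝ) ^ (-((m : ℝ) / 2 ^ (h + 1 + 2))) := by
      rw [one_div, inv_pow, ← Real.rpow_natCast, ← Real.rpow_neg (by norm_num)]
      refine Real.rpow_le_rpow_of_exponent_le (by norm_num) (neg_le_neg ?_)
      rw [div_le_iff₀ (by positivity)]
      have h2 : m < (m / 2 ^ (h + 1 + 2) + 1) * 2 ^ (h + 1 + 2) := by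
        rw [mul_comm]
        exact Nat.lt_mul_div_succ m (by positivity)
      rw [← ht] at h2
      exact_mod_cast h2.le
    refine mul_le_mul ?_ h1 (by positivity) hs0.le
    push_cast at hds
    exact hds

end final

end Collapse

/-- **Corollary 3.5 (collapse of {SYM,THR}∘AC⁰ circuits under `R_p`).** There
is an absolute constant `τ > 0`: for every depth `d` and all sufficiently large
`n = m(k+1)r` (`m = r`, `k = ⌊0.0005·log₂ m⌋`), if `F` is computed by a
`{SYM,THR}∘AC⁰_d` circuit of size `s = n^{τ·log₂ n}` and
`p = (1/48)·(48·log₂ s)^{-(d-1)}`, then the probability over `ρ ← R_p` that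
`F↾ρ` is not computed by an `(m/2, C)`-decision tree, `C` being the class of
size-`s²` SYM∘AND_{log₂ s} and THR∘AND_{log₂ s} circuits, is at most
`s·2^{-m/2^{d+2}}`. -/
theorem collapse_sym_thr_AC0 :
    ∃ τ : ℝ, 0 < τ ∧
      ∀ d : ℕ, ∃ n₀ : ℕ, ∀ m k r n : ℕ,
        n₀ ≤ n → m = r → k = ⌊(0.0005 : ℝ) * Real.logb 2 (m : ℝ)⌋₊ →
        n = m * (k + 1) * r →
        ∀ s : ℝ, s = (n : ℝ) ^ (τ * Real.logb 2 (n : ℝ)) →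
        ∀ p : ℝ, p = (1 / 48 : ℝ) * (48 * Real.logb 2 s) ^ (-((d : ℝ) - 1)) →
        ∀ F : (Fin m × Fin (k + 1) × Fin r → Bool) → Bool,
          (SymOnAC0 s d F ∨ ThrOnAC0 s d F) →
          prOf (RpDensity p)
            (fun ρ : (Fin m × Fin (k + 1) × Fin r) → Option Bool =>
              ¬ ComputedByClassDT (m / 2)
                  (fun f => IsSymAnd (s ^ 2) (Real.logb 2 s) f ∨
                    IsThrAnd (s ^ 2) (Real.logb 2 s) f)
                  (restrictF F ρ))
            ≤ s * (2 : ℝ) ^ (-((m : ℝ) / 2 ^ (d + 2))) := by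
  refine ⟨1, one_pos, fun d => ⟨2 ^ (d + 2) * (2 ^ (d + 2) + 1) * 2 ^ (d + 2) + d + 2, ?_⟩⟩
  intro m k r n hn hmr hk hnm s hs p hp F hF
  have hkm : k ≤ m := by
    rw [hk]
    refine Nat.floor_le_of_le ?_
    rcases Nat.eq_zero_or_pos m with h0 | h0
    · simp [h0]
    have hm1 : (1 : ℝ) ≤ m := by exact_mod_cast h0
    have h1 : Real.logb 2 (m : ℝ) ≤ m := by
      rw [Real.logb_le_iff_le_rpow (by norm_num) (by linarith), Real.rpow_natCast]
      exact_mod_cast (Nat.lt_two_pow_self (n := m)).le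
    linarith
  have hm : 2 ^ (d + 2) ≤ m := by
    by_contra hlt
    push Not at hlt
    have : n ≤ 2 ^ (d + 2) * (2 ^ (d + 2) + 1) * 2 ^ (d + 2) := by
      rw [hnm, ← hmr]
      exact Nat.mul_le_mul (Nat.mul_le_mul hlt.le (by omega)) hlt.le
    omega
  have hn2 : (2 : ℝ) ≤ n := by exact_mod_cast (by omega : 2 ≤ n)
  have hdn : (d : ℝ) ≤ n := by exact_mod_cast (by omega : d ≤ n)
  have hlog : 1 ≤ Real.logb 2 (n : ℝ) := by
    rw [Real.le_logb_iff_rpow_le (by norm_num) (by linarith)]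
    simpa using hn2
  have hsn : (n : ℝ) ≤ s := by
    rw [hs, one_mul]
    calc (n : ℝ) = (n : ℝ) ^ (1 : ℝ) := (Real.rpow_one _).symm
      _ ≤ _ := Real.rpow_le_rpow_of_exponent_le (by linarith) hlog
  exact Collapse.collapse_core (by linarith) (by linarith) hm hp hF
end
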